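/- arXiv:1208.2635 — 5 statements merged into one kernel-verified Lean document; each statement's English description precedes it below -/
import Mathlib

section
/- Assume ν_{s⋆} > 0 (so the columns of X_{J⋆} are linearly independent) and let β̂_{J⋆} be the least-squares coefficient vector on J⋆, i.e., the vector supported in J⋆ agreeing on J⋆ with (X_{J⋆}^⊤X_{J⋆})^(−1)X_{J⋆}^⊤ y. Then for every r > 0: the probability (over the Gaussian noise z) that ‖β̂_{J⋆} − β⋆‖_∞ > r is at most s⋆·exp(−n·ν_{s⋆}²·r²/(2σ²)). -/
open MeasureTheory ProbabilityTheory Finset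
open scoped Classical ENNReal

/-- A linear combination of independent centered Gaussians of variance `v` is Gaussian. -/
theorem map_pi_gaussianReal_sum_mul {ι : Type*} [Fintype ι] (v : NNReal) (a : ι → ℝ) :
    (Measure.pi fun _ : ι => gaussianReal 0 v).map (fun z => ∑ i, a i * z i)
      = gaussianReal 0 (v * Real.toNNReal (∑ i, a i ^ 2)) := by
  have hind : iIndepFun (fun i (z : ι → ℝ) => a i * z i)
      (Measure.pi fun _ : ι => gaussianReal 0 v) :=
    iIndepFun_pi (X := fun i x => a i * x) fun i => (measurable_const_mul (a i)).aemeasurable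
  apply Measure.ext_of_charFun
  rw [hind.charFun_map_fun_sum_eq_prod fun i =>
    ((measurable_pi_apply i).const_mul (a i)).aemeasurable]
  funext t
  have hmap (i : ι) : (Measure.pi fun _ : ι => gaussianReal 0 v).map (fun z => a i * z i)
      = gaussianReal 0 (NNReal.mk (a i ^ 2) (sq_nonneg _) * v) := by
    have h := (measurePreserving_eval (fun _ : ι => gaussianReal 0 v) i).map_eq
    have h2 := gaussianReal_map_const_mul (μ := 0) (v := v) (a i)
    rw [mul_zero] at h2
    rw [← h2]
    conv_rhs => rw [← h]
    rw [Measure.map_map (by fun_prop) (by fun_prop)]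
    rfl
  rw [Finset.prod_apply]
  simp_rw [hmap, charFun_gaussianReal]
  rw [← Complex.exp_sum]
  congr 1
  simp only [NNReal.coe_mul, NNReal.coe_mk,
    Real.coe_toNNReal _ (Finset.sum_nonneg fun i _ => sq_nonneg (a i))]
  push_cast
  simp [Finset.sum_mul, Finset.mul_sum, Finset.sum_div]
  exact Finset.sum_congr rfl fun i _ => by ring

theorem gaussianReal_Ioi_le {v : NNReal} (hv : v ≠ 0) {t : ℝ} (ht : 0 ≤ t) :
    gaussianReal 0 v (Set.Ioi t)
      ≤ ENNReal.ofReal (Real.exp (-t ^ 2 / (2 * v))) * gaussianReal 0 v (Set.Ioi 0) := by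
  have hpre : (fun x : ℝ => x + t) ⁻¹' Set.Ioi t = Set.Ioi 0 := by ext x; simp
  have hcv := (measurePreserving_add_right volume t).setLIntegral_comp_preimage
    (measurableSet_Ioi (a := t)) (measurable_gaussianPDF 0 v)
  rw [gaussianReal_apply _ hv, gaussianReal_apply _ hv, ← hcv, hpre,
    ← lintegral_const_mul _ (measurable_gaussianPDF 0 v)]
  refine setLIntegral_mono ((measurable_gaussianPDF 0 v).const_mul _) fun x hx => ?_
  have hx : 0 < x := hx
  have hv' : (0 : ℝ) < v := by positivity
  rw [gaussianPDF, gaussianPDF, ← ENNReal.ofReal_mul (Real.exp_nonneg _)]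
  apply ENNReal.ofReal_le_ofReal
  rw [gaussianPDFReal, gaussianPDFReal, mul_left_comm, ← Real.exp_add, ← add_div]
  gcongr
  nlinarith [mul_nonneg hx.le ht]

/-- Two-sided Gaussian tail bound with constant one. -/
theorem gaussianReal_abs_gt_le {v : NNReal} (hv : v ≠ 0) {t : ℝ} (ht : 0 ≤ t) :
    gaussianReal 0 v {x | t < |x|} ≤ ENNReal.ofReal (Real.exp (-t ^ 2 / (2 * v))) := by
  have hneg (s : ℝ) : gaussianReal 0 v (Set.Iio (-s)) = gaussianReal 0 v (Set.Ioi s) := by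
    have h := gaussianReal_map_neg (μ := 0) (v := v)
    rw [neg_zero] at h
    conv_lhs => rw [← h]
    rw [Measure.map_apply measurable_neg measurableSet_Iio]
    congr 1
    ext x
    simp
  have hset : {x : ℝ | t < |x|} ⊆ Set.Iio (-t) ∪ Set.Ioi t := fun x hx => by
    rcases lt_abs.1 (show t < |x| from hx) with h | h
    · exact Or.inr h
    · exact Or.inl (lt_neg_of_lt_neg h)
  calc gaussianReal 0 v {x | t < |x|}
      ≤ gaussianReal 0 v (Set.Iio (-t)) + gaussianReal 0 v (Set.Ioi t) :=
        (measure_mono hset).trans (measure_union_le _ _)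
    _ ≤ ENNReal.ofReal (Real.exp (-t ^ 2 / (2 * v))) *
          (gaussianReal 0 v (Set.Iio 0) + gaussianReal 0 v (Set.Ioi 0)) := by
        have h0 := hneg 0
        rw [neg_zero] at h0
        rw [hneg, h0, mul_add]
        gcongr <;> exact gaussianReal_Ioi_le hv ht
    _ ≤ _ := by
        rw [← measure_union (Set.Iio_disjoint_Ioi_of_le le_rfl) measurableSet_Ioi]
        exact mul_le_of_le_one_right' prob_le_one

/-- If `X` is injective on vectors supported in `J`, each coordinate functional is represented on such
vectors by the form `(e, w) ↦ ⟪X e, X w⟫`. -/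
theorem exists_mulVec_dual_vector {n p : ℕ} (X : Matrix (Fin n) (Fin p) ℝ) (J : Finset (Fin p))
    (hinj : ∀ w : Fin p → ℝ, (∀ j ∉ J, w j = 0) → X.mulVec w = 0 → w = 0) (j : Fin p) :
    ∃ w : Fin p → ℝ, (∀ k ∉ J, w k = 0) ∧
      ∀ e : Fin p → ℝ, (∀ k ∉ J, e k = 0) → X.mulVec e ⬝ᵥ X.mulVec w = e j := by
  let V : Submodule ℝ (Fin p → ℝ) :=
    { carrier := {w | ∀ k ∉ J, w k = 0}
      add_mem' := fun {a b} ha hb k hk => by simp [ha k hk, hb k hk]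
      zero_mem' := fun _ _ => rfl
      smul_mem' := fun c a ha k hk => by simp [ha k hk] }
  let B : LinearMap.BilinForm ℝ V :=
    LinearMap.mk₂ ℝ (fun w e => X.mulVec e.1 ⬝ᵥ X.mulVec w.1)
      (fun a b c => by simp [Matrix.mulVec_add])
      (fun c a b => by simp [Matrix.mulVec_smul])
      (fun a b c => by simp [Matrix.mulVec_add])
      (fun c a b => by simp [Matrix.mulVec_smul])
  have hB : Function.Injective B := by
    refine (injective_iff_map_eq_zero B).2 fun w hw => Subtype.ext (hinj w.1 w.2 ?_)
    exact dotProduct_self_eq_zero.1 (LinearMap.congr_fun hw w)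
  obtain ⟨w, hw⟩ : ∃ w : V, B w = (LinearMap.proj j).comp V.subtype :=
    (LinearMap.linearEquivOfInjective B hB Subspace.dual_finrank_eq.symm).surjective _
  exact ⟨w.1, w.2, fun e he => LinearMap.congr_fun hw ⟨e, he⟩⟩

/-- The restricted eigenvalue of `X` at sparsity level `s`, as an infimum over unit vectors,
bounds the quadratic form from below on all `s`-sparse vectors. -/
theorem sq_mul_sum_sq_le_sum_mulVec_sq {n p : ℕ} (hn : 1 ≤ n) (X : Matrix (Fin n) (Fin p) ℝ)
    {s c : ℝ} (hc : c = sInf {r : ℝ | ∃ (J : Finset (Fin p)) (u : Fin p → ℝ),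
        (J.card : ℝ) ≤ s ∧ (∀ j ∉ J, u j = 0) ∧ (∑ j, (u j)^2) = 1 ∧
        r = Real.sqrt (∑ i, (X.mulVec u i)^2) / Real.sqrt n})
    (hc0 : 0 ≤ c) {J : Finset (Fin p)} (hJ : (J.card : ℝ) ≤ s) {w : Fin p → ℝ}
    (hw : ∀ j ∉ J, w j = 0) :
    n * c ^ 2 * ∑ j, w j ^ 2 ≤ ∑ i, X.mulVec w i ^ 2 := by
  have hn' : (0 : ℝ) < n := by exact_mod_cast hn
  have hS : 0 ≤ ∑ j, w j ^ 2 := sum_nonneg fun j _ => sq_nonneg (w j)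
  have hT : 0 ≤ ∑ i, X.mulVec w i ^ 2 := sum_nonneg fun i _ => sq_nonneg _
  rcases hS.eq_or_lt with h0 | hpos
  · rw [← h0, mul_zero]
    exact hT
  set S := ∑ j, w j ^ 2
  set T := ∑ i, X.mulVec w i ^ 2
  have hle : c ≤ Real.sqrt (T / S) / Real.sqrt n := by
    rw [hc]
    refine csInf_le ⟨0, ?_⟩ ⟨J, (Real.sqrt S)⁻¹ • w, hJ, fun j hj => by simp [hw j hj], ?_, ?_⟩
    · rintro r ⟨-, -, -, -, -, rfl⟩
      positivity
    · simp only [Pi.smul_apply, smul_eq_mul, mul_pow, inv_pow, Real.sq_sqrt hS, ← mul_sum]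
      exact inv_mul_cancel₀ hpos.ne'
    · simp only [Matrix.mulVec_smul, Pi.smul_apply, smul_eq_mul, mul_pow, inv_pow,
        Real.sq_sqrt hS, ← mul_sum]
      rw [div_eq_inv_mul T S]
  have hsq := pow_le_pow_left₀ hc0 hle 2
  rw [div_pow, Real.sq_sqrt (by positivity), Real.sq_sqrt hn'.le, div_div,
    le_div_iff₀ (by positivity)] at hsq
  linarith

theorem stmt15
    (n p : ℕ) (hn : 1 ≤ n) (hnp : n ≤ p)
    (X : Matrix (Fin n) (Fin p) ℝ)
    (hX : ∀ j, Real.sqrt (∑ i, (X i j)^2) = Real.sqrt n)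
    (σ : ℝ) (hσ : 0 < σ)
    (μ : Measure (Fin n → ℝ))
    (hμ : μ = Measure.pi (fun _ : Fin n => gaussianReal 0 (Real.toNNReal (σ^2))))
    (βs : Fin p → ℝ) (sstar : ℕ) (hs1 : 1 ≤ sstar)
    (Jstar : Finset (Fin p)) (hJstar : Jstar = Finset.univ.filter (fun j => βs j ≠ 0))
    (hcard : Jstar.card = sstar)
    (nu : ℝ → ℝ)
    (hnu : ∀ s : ℝ, nu s = sInf {r : ℝ | ∃ (J : Finset (Fin p)) (u : Fin p → ℝ),
        (J.card : ℝ) ≤ s ∧ (∀ j ∉ J, u j = 0) ∧ (∑ j, (u j)^2) = 1 ∧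
        r = Real.sqrt (∑ i, (X.mulVec u i)^2) / Real.sqrt n})
    (y : (Fin n → ℝ) → Fin n → ℝ)
    (hy : ∀ z i, y z i = X.mulVec βs i + z i)
    (hI : 0 < nu (sstar : ℝ))
    (bh : (Fin n → ℝ) → Fin p → ℝ)
    (hbh : ∀ z, (∀ j ∉ Jstar, bh z j = 0)
        ∧ ∀ j ∈ Jstar, (∑ i, (y z i - X.mulVec (bh z) i) * X i j) = 0)
    :
    ∀ r : ℝ, 0 < r →
      μ {z | ∃ j, r < |bh z j - βs j|}
        ≤ ENNReal.ofReal ((sstar : ℝ) *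
            Real.exp (-((n : ℝ) * (nu (sstar : ℝ))^2 * r^2) / (2 * σ^2))) := by
  intro r hr
  subst hμ
  set c := nu sstar with hc_def
  have hn' : (0 : ℝ) < n := by exact_mod_cast hn
  have hlow : ∀ w : Fin p → ℝ, (∀ j ∉ Jstar, w j = 0) →
      n * c ^ 2 * ∑ j, w j ^ 2 ≤ ∑ i, X.mulVec w i ^ 2 := fun w hw =>
    sq_mul_sum_sq_le_sum_mulVec_sq hn X (hnu sstar) hI.le (by rw [hcard]) hw
  have hinj : ∀ w : Fin p → ℝ, (∀ j ∉ Jstar, w j = 0) → X.mulVec w = 0 → w = 0 := by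
    intro w hw h0
    have h := hlow w hw
    simp only [h0, Pi.zero_apply, ne_eq, OfNat.ofNat_ne_zero, not_false_eq_true, zero_pow,
      sum_const_zero] at h
    have hS : ∑ j, w j ^ 2 = 0 :=
      le_antisymm (nonpos_of_mul_nonpos_right h (by positivity))
        (sum_nonneg fun j _ => sq_nonneg _)
    funext j
    exact pow_eq_zero_iff two_ne_zero |>.1
      ((sum_eq_zero_iff_of_nonneg fun j _ => sq_nonneg (w j)).1 hS j (mem_univ j))
  have hβ : ∀ j ∉ Jstar, βs j = 0 := fun j hj => by
    by_contra h
    exact hj (by simp [hJstar, h])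
  have hsupp : ∀ z, ∀ j ∉ Jstar, (bh z - βs) j = 0 := fun z j hj => by
    simp [(hbh z).1 j hj, hβ j hj]
  have htail : ∀ j ∈ Jstar,
      Measure.pi (fun _ : Fin n => gaussianReal 0 (Real.toNNReal (σ ^ 2)))
        {z | r < |bh z j - βs j|}
      ≤ ENNReal.ofReal (Real.exp (-(n * c ^ 2 * r ^ 2) / (2 * σ ^ 2))) := by
    intro j hj
    obtain ⟨w, hw, hdual⟩ := exists_mulVec_dual_vector X Jstar hinj j
    have herr : ∀ z, bh z j - βs j = ∑ i, X.mulVec w i * z i := by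
      intro z
      have hres : (y z - X.mulVec (bh z)) ⬝ᵥ X.mulVec w = 0 := by
        rw [Matrix.dotProduct_mulVec]
        refine sum_eq_zero fun k _ => ?_
        by_cases hk : k ∈ Jstar
        · rw [show Matrix.vecMul (y z - X.mulVec (bh z)) X k = 0 from (hbh z).2 k hk, zero_mul]
        · rw [hw k hk, mul_zero]
      have hy' : y z = X.mulVec βs + z := funext (hy z)
      have hd := hdual _ (hsupp z)
      rw [Matrix.mulVec_sub, sub_dotProduct] at hd
      rw [hy', sub_dotProduct, add_dotProduct] at hres
      change (bh z - βs) j = X.mulVec w ⬝ᵥ z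
      rw [dotProduct_comm (X.mulVec w) z]
      linarith
    set A := ∑ i, X.mulVec w i ^ 2 with hA
    have hAw : A = w j := by
      rw [← hdual w hw, hA]
      exact sum_congr rfl fun i _ => sq _
    have hA0 : 0 ≤ A := sum_nonneg fun i _ => sq_nonneg _
    have hApos : 0 < A := by
      refine hA0.lt_of_ne' fun h => ?_
      have hXw : X.mulVec w = 0 := by
        rw [← dotProduct_self_eq_zero, hdual w hw, ← hAw, h]
      have h1 := hdual (Pi.single j 1) fun k hk =>
        Pi.single_eq_of_ne (ne_of_mem_of_not_mem hj hk).symm 1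
      simp [hXw] at h1
    have hAle : n * c ^ 2 * A ≤ 1 := by
      have h1 : A ^ 2 ≤ ∑ k, w k ^ 2 := by
        rw [hAw]
        exact single_le_sum (f := fun k => w k ^ 2) (fun k _ => sq_nonneg _) (mem_univ j)
      have h2 := (mul_le_mul_of_nonneg_left h1 (by positivity : 0 ≤ n * c ^ 2)).trans (hlow w hw)
      rw [← hA] at h2
      refine le_of_mul_le_mul_right ?_ hApos
      linarith
    have hv : (σ ^ 2).toNNReal * A.toNNReal ≠ 0 := by positivity
    have hset : {z | r < |bh z j - βs j|}
        = (fun z => ∑ i, X.mulVec w i * z i) ⁻¹' {x | r < |x|} := by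
      ext z
      simp [herr z]
    rw [hset, ← Measure.map_apply (by fun_prop) (measurableSet_lt (by fun_prop) (by fun_prop)),
      map_pi_gaussianReal_sum_mul, ← hA]
    refine (gaussianReal_abs_gt_le hv hr.le).trans (ENNReal.ofReal_le_ofReal ?_)
    rw [NNReal.coe_mul, Real.coe_toNNReal _ (sq_nonneg σ), Real.coe_toNNReal _ hA0, neg_div,
      neg_div]
    refine Real.exp_le_exp.2 (neg_le_neg ?_)
    rw [div_le_div_iff₀ (by positivity) (by positivity)]
    nlinarith [mul_le_mul_of_nonneg_left hAle (by positivity : 0 ≤ r ^ 2 * (2 * σ ^ 2))]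
  have hunion : {z | ∃ j, r < |bh z j - βs j|} ⊆ ⋃ j ∈ Jstar, {z | r < |bh z j - βs j|} := by
    rintro z ⟨j, hz⟩
    refine Set.mem_biUnion (x := j) ?_ hz
    by_contra hj
    have h0 : bh z j - βs j = 0 := hsupp z j hj
    rw [h0, abs_zero] at hz
    exact hr.not_gt hz
  calc _ ≤ ∑ j ∈ Jstar, _ := (measure_mono hunion).trans (measure_biUnion_finset_le _ _)
    _ ≤ ∑ j ∈ Jstar, ENNReal.ofReal (Real.exp (-(n * c ^ 2 * r ^ 2) / (2 * σ ^ 2))) :=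
        sum_le_sum htail
    _ = _ := by
        rw [sum_const, hcard, nsmul_eq_mul, ENNReal.ofReal_mul (Nat.cast_nonneg _),
          ENNReal.ofReal_natCast]
end

section
/- Fix ε > 0 and c ≥ 1, assume Condition I((2+ε)s⋆) holds, take λ = ((1+ε)/ε)·(23 + 5c)·log p, and assume min_{j ∈ J⋆} |β⋆_j| ≥ 3σ·√(λ/n)/ν_{(2+ε)s⋆}. Then with probability at least 1 − 6p^(−c) over the Gaussian noise z, Π has a unique maximizer among the subsets of {1,…,p}, and this maximizer equals J⋆ (i.e., the maximum a posteriori support estimate Ĵ_map satisfies Ĵ_map = J⋆). -/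
open MeasureTheory ProbabilityTheory Finset
open scoped Classical ENNReal

/-- Tonelli for a product of functions of independent coordinates. -/
theorem lintegral_pi_prod {ι : Type*} [Fintype ι] (μ : ι → Measure ℝ)
    [∀ i, IsProbabilityMeasure (μ i)] (f : ι → ℝ → ℝ≥0∞) (hf : ∀ i, Measurable (f i)) :
    ∫⁻ x, ∏ i, f i (x i) ∂Measure.pi μ = ∏ i, ∫⁻ t, f i t ∂μ i := by
  rw [lintegral_prod_eq_prod_lintegral_of_indepFun univ (fun i (x : ι → ℝ) => f i (x i))
    (iIndepFun_pi fun i => (hf i).aemeasurable) fun i => (hf i).comp (measurable_pi_apply i)]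
  refine Finset.prod_congr rfl fun i _ => ?_
  exact (measurePreserving_eval μ i).lintegral_comp (hf i)

/-- Moment generating function of a linear form in independent centred Gaussians. -/
theorem lintegral_exp_linear_gaussian {ι : Type*} [Fintype ι] (v : NNReal) (a : ι → ℝ) :
    ∫⁻ x, ENNReal.ofReal (Real.exp (∑ i, a i * x i)) ∂Measure.pi (fun _ : ι => gaussianReal 0 v)
      = ENNReal.ofReal (Real.exp (v * (∑ i, a i ^ 2) / 2)) := by
  have h1 : ∀ i, ∫⁻ t, ENNReal.ofReal (Real.exp (a i * t)) ∂gaussianReal 0 v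
      = ENNReal.ofReal (Real.exp (v * a i ^ 2 / 2)) := fun i => by
    rw [← ofReal_integral_eq_lintegral_ofReal (integrable_exp_mul_gaussianReal _)
      (ae_of_all _ fun _ => (Real.exp_pos _).le)]
    have := congrFun (mgf_id_gaussianReal (μ := 0) (v := v)) (a i)
    simp only [mgf, id, zero_mul, zero_add] at this
    rw [this]
  simp_rw [Real.exp_sum, ENNReal.ofReal_prod_of_nonneg fun i _ => (Real.exp_pos _).le]
  rw [lintegral_pi_prod (fun _ => gaussianReal 0 v)
    (fun i t => ENNReal.ofReal (Real.exp (a i * t))) fun i => by fun_prop]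
  simp_rw [h1]
  rw [← ENNReal.ofReal_prod_of_nonneg fun i _ => (Real.exp_pos _).le, ← Real.exp_sum,
    Finset.mul_sum, Finset.sum_div]

theorem lintegral_exp_sq_gaussian :
    ∫⁻ t, ENNReal.ofReal (Real.exp (t ^ 2 / 4)) ∂gaussianReal 0 1 = ENNReal.ofReal √2 := by
  have h : ∫ t, Real.exp (t ^ 2 / 4) ∂gaussianReal 0 1 = √2 := by
    rw [integral_gaussianReal_eq_integral_smul one_ne_zero]
    have : ∀ x : ℝ, gaussianPDFReal 0 1 x • Real.exp (x ^ 2 / 4)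
        = (√(2 * Real.pi))⁻¹ * Real.exp (-(1 / 4) * x ^ 2) := fun x => by
      rw [gaussianPDFReal, smul_eq_mul, mul_assoc, ← Real.exp_add]
      simp only [NNReal.coe_one, mul_one]
      congr 2
      ring
    simp_rw [this]
    rw [integral_const_mul, integral_gaussian, ← Real.sqrt_inv,
      ← Real.sqrt_mul (by positivity)]
    congr 1
    field_simp
    norm_num
  rw [← ofReal_integral_eq_lintegral_ofReal (Integrable.of_integral_ne_zero (by rw [h]; positivity))
    (ae_of_all _ fun _ => (Real.exp_pos _).le), h]

theorem sq_norm_starProjection_eq_sum {n : ℕ} (U : Submodule ℝ (EuclideanSpace ℝ (Fin n)))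
    (x : EuclideanSpace ℝ (Fin n)) :
    ‖U.starProjection x‖ ^ 2
      = ∑ i, (inner ℝ (stdOrthonormalBasis ℝ U i : EuclideanSpace ℝ (Fin n)) x) ^ 2 := by
  rw [Submodule.starProjection_apply, ← Submodule.coe_norm,
    ← (stdOrthonormalBasis ℝ U).sum_sq_norm_inner_right]
  refine Finset.sum_congr rfl fun i _ => ?_
  rw [Submodule.inner_orthogonalProjectionOnto_eq_of_mem_left, Real.norm_eq_abs, sq_abs]

/-- Exponential moment of the squared norm of a projected Gaussian vector. -/
theorem lintegral_exp_sq_norm_starProjection {n : ℕ} {σ : ℝ} (hσ : 0 < σ)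
    (U : Submodule ℝ (EuclideanSpace ℝ (Fin n))) :
    ∫⁻ z, ENNReal.ofReal (Real.exp (‖U.starProjection (WithLp.toLp 2 z)‖ ^ 2 / (4 * σ ^ 2)))
        ∂Measure.pi (fun _ : Fin n => gaussianReal 0 (Real.toNNReal (σ ^ 2)))
      = ENNReal.ofReal √2 ^ Module.finrank ℝ U := by
  set b := stdOrthonormalBasis ℝ U with hb
  set γ := Measure.pi (fun _ : Fin (Module.finrank ℝ U) => gaussianReal 0 1)
  set μ := Measure.pi (fun _ : Fin n => gaussianReal 0 (Real.toNNReal (σ ^ 2)))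
  have hs2 : √2 ^ 2 = (2 : ℝ) := Real.sq_sqrt (by norm_num)
  have key : ∀ z : Fin n → ℝ,
      ENNReal.ofReal (Real.exp (‖U.starProjection (WithLp.toLp 2 z)‖ ^ 2 / (4 * σ ^ 2)))
      = ∫⁻ g, ENNReal.ofReal (Real.exp (∑ i,
          (inner ℝ (b i : EuclideanSpace ℝ (Fin n)) (WithLp.toLp 2 z) / (√2 * σ)) * g i)) ∂γ := by
    intro z
    rw [lintegral_exp_linear_gaussian, sq_norm_starProjection_eq_sum]
    congr 2
    simp only [NNReal.coe_one, one_mul, div_pow, mul_pow, hs2]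
    rw [← Finset.sum_div]
    field_simp
    norm_num
    exact mul_comm _ _
  simp_rw [key]
  rw [lintegral_lintegral_swap (by
    simp only [PiLp.inner_apply]
    fun_prop)]
  have key2 : ∀ g : Fin (Module.finrank ℝ U) → ℝ,
      ∫⁻ z, ENNReal.ofReal (Real.exp (∑ i,
          (inner ℝ (b i : EuclideanSpace ℝ (Fin n)) (WithLp.toLp 2 z) / (√2 * σ)) * g i)) ∂μ
      = ∏ i, ENNReal.ofReal (Real.exp (g i ^ 2 / 4)) := by
    intro g
    have h1 : ∀ z : Fin n → ℝ,
        ∑ i, (inner ℝ (b i : EuclideanSpace ℝ (Fin n)) (WithLp.toLp 2 z) / (√2 * σ)) * g i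
        = ∑ k, ((∑ i, g i • b i : U) : EuclideanSpace ℝ (Fin n)) k / (√2 * σ) * z k := by
      intro z
      have : ∑ k, ((∑ i, g i • b i : U) : EuclideanSpace ℝ (Fin n)) k * z k
          = inner ℝ ((∑ i, g i • b i : U) : EuclideanSpace ℝ (Fin n)) (WithLp.toLp 2 z) := by
        simp [PiLp.inner_apply, mul_comm]
      simp_rw [div_mul_eq_mul_div]
      rw [← Finset.sum_div, ← Finset.sum_div, this, Submodule.coe_sum, sum_inner]
      congr 1
      refine Finset.sum_congr rfl fun i _ => ?_
      rw [Submodule.coe_smul, real_inner_smul_left, mul_comm]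
    simp_rw [h1]
    rw [lintegral_exp_linear_gaussian, ← ENNReal.ofReal_prod_of_nonneg
      fun i _ => (Real.exp_pos _).le, ← Real.exp_sum]
    congr 2
    have h2 : ∑ k, ((∑ i, g i • b i : U) : EuclideanSpace ℝ (Fin n)) k ^ 2 = ∑ i, g i ^ 2 := by
      rw [← EuclideanSpace.real_norm_sq_eq, ← Submodule.coe_norm,
        ← b.sum_sq_norm_inner_right]
      refine Finset.sum_congr rfl fun i _ => ?_
      rw [b.orthonormal.inner_right_fintype, Real.norm_eq_abs, sq_abs]
    simp_rw [div_pow, mul_pow, hs2]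
    rw [← Finset.sum_div, ← Finset.sum_div, h2, Real.coe_toNNReal _ (sq_nonneg σ)]
    field_simp
    norm_num
  simp_rw [key2]
  rw [lintegral_pi_prod (fun _ => gaussianReal 0 1)
    (fun _ t => ENNReal.ofReal (Real.exp (t ^ 2 / 4))) fun i => by fun_prop]
  simp [lintegral_exp_sq_gaussian]

/-- Chi-square tail bound, in the form used for a union bound over models. -/
theorem measure_sq_norm_starProjection_gt {n : ℕ} {σ : ℝ} (hσ : 0 < σ)
    (U : Submodule ℝ (EuclideanSpace ℝ (Fin n))) {d : ℕ} (hd : Module.finrank ℝ U ≤ d)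
    {c L : ℝ} (hL : Real.log 2 ≤ L) :
    Measure.pi (fun _ : Fin n => gaussianReal 0 (Real.toNNReal (σ ^ 2)))
      {z | σ ^ 2 * ((6 + 4 * c) * d * L) < ‖U.starProjection (WithLp.toLp 2 z)‖ ^ 2}
      ≤ ENNReal.ofReal (Real.exp (-(1 + c) * L) ^ d) := by
  set μ := Measure.pi (fun _ : Fin n => gaussianReal 0 (Real.toNNReal (σ ^ 2)))
  set t := Real.exp ((6 + 4 * c) * d * L / 4) with ht
  have h1 := mul_meas_ge_le_lintegral₀ (μ := μ) (f := fun z : Fin n → ℝ =>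
    ENNReal.ofReal (Real.exp (‖U.starProjection (WithLp.toLp 2 z)‖ ^ 2 / (4 * σ ^ 2))))
    (by fun_prop) (ENNReal.ofReal t)
  rw [lintegral_exp_sq_norm_starProjection hσ] at h1
  have h2 : {z : Fin n → ℝ | σ ^ 2 * ((6 + 4 * c) * d * L)
        < ‖U.starProjection (WithLp.toLp 2 z)‖ ^ 2} ⊆
      {z | ENNReal.ofReal t ≤
        ENNReal.ofReal (Real.exp (‖U.starProjection (WithLp.toLp 2 z)‖ ^ 2 / (4 * σ ^ 2)))} := by
    intro z hz
    simp only [Set.mem_ofPred_eq] at hz ⊢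
    refine ENNReal.ofReal_le_ofReal (Real.exp_le_exp.2 ?_)
    rw [div_le_div_iff₀ (by norm_num) (by positivity)]
    nlinarith
  refine (measure_mono h2).trans ?_
  have ht0 : 0 < t := Real.exp_pos _
  rw [← ENNReal.mul_le_mul_iff_right (a := ENNReal.ofReal t) (by simpa using ht0)
    ENNReal.ofReal_ne_top]
  refine h1.trans ?_
  rw [← ENNReal.ofReal_pow (by positivity), ← ENNReal.ofReal_mul ht0.le]
  refine ENNReal.ofReal_le_ofReal ?_
  have hs : √2 = Real.exp (Real.log 2 / 2) := by
    rw [Real.sqrt_eq_rpow, Real.rpow_def_of_pos (by norm_num)]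
    ring_nf
  have hd' : (Module.finrank ℝ U : ℝ) ≤ d := by exact_mod_cast hd
  rw [hs, ← Real.exp_nat_mul, ← Real.exp_nat_mul, ht, ← Real.exp_add, Real.exp_le_exp]
  have := mul_le_mul hd' hL (Real.log_nonneg (by norm_num)) (Nat.cast_nonneg d)
  linarith

section Subspaces

variable {E : Type*} [NormedAddCommGroup E] [InnerProductSpace ℝ E] [FiniteDimensional ℝ E]

theorem starProjection_orthogonal_inf {V W : Submodule ℝ E} (h : V ≤ W) (y : E) :
    (Vᗮ ⊓ W).starProjection y = W.starProjection y - V.starProjection y := by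
  refine Submodule.eq_starProjection_of_mem_of_inner_eq_zero ⟨?_, ?_⟩ fun w hw => ?_
  · have h1 := Submodule.sub_starProjection_mem_orthogonal (K := V) y
    have h2 := Submodule.orthogonal_le h (Submodule.sub_starProjection_mem_orthogonal (K := W) y)
    simpa using Vᗮ.sub_mem h1 h2
  · exact W.sub_mem (Submodule.starProjection_apply_mem W y)
      (h (Submodule.starProjection_apply_mem V y))
  · have h1 : inner ℝ (y - W.starProjection y) w = 0 :=
      Submodule.starProjection_inner_eq_zero y w hw.2
    have h2 : inner ℝ (V.starProjection y) w = 0 :=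
      hw.1 _ (Submodule.starProjection_apply_mem V y)
    rw [← sub_add, inner_add_left, h1, h2, add_zero]

theorem sq_norm_sub_starProjection {V W : Submodule ℝ E} (h : V ≤ W) (y : E) :
    ‖y - V.starProjection y‖ ^ 2
      = ‖y - W.starProjection y‖ ^ 2 + ‖(Vᗮ ⊓ W).starProjection y‖ ^ 2 := by
  have h1 : inner ℝ (y - W.starProjection y) ((Vᗮ ⊓ W).starProjection y) = 0 :=
    Submodule.starProjection_inner_eq_zero y _ (Submodule.starProjection_apply_mem (Vᗮ ⊓ W) y).2
  have h2 := norm_add_sq_eq_norm_sq_add_norm_sq_of_inner_eq_zero _ _ h1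
  rw [starProjection_orthogonal_inf h, sub_add_sub_cancel] at h2
  rw [starProjection_orthogonal_inf h, sq, sq, sq, h2]

theorem starProjection_orthogonal_inf_add_of_mem {V : Submodule ℝ E} (W : Submodule ℝ E) {f : E}
    (hf : f ∈ V) (z : E) :
    (Vᗮ ⊓ W).starProjection (f + z) = (Vᗮ ⊓ W).starProjection z := by
  have : (Vᗮ ⊓ W).starProjection f = 0 := by
    rw [Submodule.starProjection_apply_eq_zero_iff]
    exact fun w hw => by rw [real_inner_comm]; exact hw.1 f hf
  rw [map_add, this, zero_add]

theorem finrank_orthogonal_inf_span_union {ι : Type*} [DecidableEq ι] (x : ι → E)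
    (A B : Finset ι) :
    Module.finrank ℝ ((Submodule.span ℝ (x '' A))ᗮ ⊓ Submodule.span ℝ (x '' (A ∪ B : Finset ι)) :
      Submodule ℝ E) ≤ (B \ A).card := by
  have hle : Submodule.span ℝ (x '' A) ≤ Submodule.span ℝ (x '' (A ∪ B : Finset ι)) :=
    Submodule.span_mono (Set.image_mono (by simp))
  have h1 := Submodule.finrank_add_inf_finrank_orthogonal hle
  have h2 : Submodule.span ℝ (x '' (A ∪ B : Finset ι))
      = Submodule.span ℝ (x '' A) ⊔ Submodule.span ℝ (x '' (B \ A : Finset ι)) := by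
    rw [← Submodule.span_union, ← Set.image_union, ← Finset.coe_union,
      Finset.union_sdiff_self_eq_union]
  have h3 := Submodule.finrank_add_le_finrank_add_finrank (Submodule.span ℝ (x '' A))
    (Submodule.span ℝ (x '' (B \ A : Finset ι)))
  have h4 : Module.finrank ℝ (Submodule.span ℝ (x '' (B \ A : Finset ι))) ≤ (B \ A).card := by
    rw [← Finset.coe_image]
    exact (finrank_span_finset_le_card _).trans Finset.card_image_le
  rw [← h2] at h3
  omega

end Subspaces

theorem sq_norm_add_ge {E : Type*} [SeminormedAddCommGroup E] (a b : E) :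
    ‖a‖ ^ 2 / 2 - ‖b‖ ^ 2 ≤ ‖a + b‖ ^ 2 := by
  have h : ‖a‖ ≤ ‖a + b‖ + ‖b‖ := by simpa using norm_sub_le (a + b) b
  nlinarith [norm_nonneg a, norm_nonneg b, norm_nonneg (a + b), sq_nonneg (‖a + b‖ - ‖b‖)]

theorem choose_succ_le (p k : ℕ) : p.choose (k + 1) ≤ p.choose k * p := by
  have := Nat.choose_succ_right_eq p k
  nlinarith [Nat.sub_le p k, Nat.zero_le (p.choose (k + 1)), Nat.zero_le (p.choose k)]

theorem choose_le_succ {p k : ℕ} (h : k + 1 ≤ p) : p.choose k ≤ p.choose (k + 1) * p := by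
  have h1 := Nat.choose_succ_right_eq p k
  have h2 : 1 ≤ p - k := by omega
  nlinarith [Nat.zero_le (p.choose (k + 1)), Nat.zero_le (p.choose k)]

theorem choose_add_le (p k d : ℕ) : p.choose (k + d) ≤ p.choose k * p ^ d := by
  induction d with
  | zero => simp
  | succ d ih =>
    calc p.choose (k + (d + 1)) ≤ p.choose (k + d) * p := choose_succ_le p (k + d)
      _ ≤ p.choose k * p ^ d * p := Nat.mul_le_mul_right p ih
      _ = _ := by ring

theorem choose_le_add (p k d : ℕ) (h : k + d ≤ p) : p.choose k ≤ p.choose (k + d) * p ^ d := by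
  induction d with
  | zero => simp
  | succ d ih =>
    calc p.choose k ≤ p.choose (k + d) * p ^ d := ih (by omega)
      _ ≤ (p.choose (k + d + 1) * p) * p ^ d := Nat.mul_le_mul_right _ (choose_le_succ (by omega))
      _ = _ := by ring_nf

/-- Binomial coefficients of nearby orders are comparable. -/
theorem choose_le_choose_mul_pow {p k s d : ℕ} (hp : 1 ≤ p) (hk : k ≤ p) (h1 : k ≤ s + d)
    (h2 : s ≤ k + d) : p.choose s ≤ p.choose k * p ^ d := by
  rcases le_total k s with h | h
  · obtain ⟨e, rfl⟩ := Nat.exists_eq_add_of_le h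
    exact (choose_add_le p k e).trans
      (Nat.mul_le_mul_left _ (Nat.pow_le_pow_right hp (by omega)))
  · obtain ⟨e, rfl⟩ := Nat.exists_eq_add_of_le h
    exact (choose_le_add p s e hk).trans
      (Nat.mul_le_mul_left _ (Nat.pow_le_pow_right hp (by omega)))

/-- Weighted count of the models other than `J₀`, by distance to `J₀`. -/
theorem sum_pow_card_symmDiff {p : ℕ} (J₀ : Finset (Fin p)) (q : ℝ) :
    ∑ J ∈ univ.erase J₀, q ^ (symmDiff J J₀).card = (1 + q) ^ p - 1 := by
  have h1 : ∑ J : Finset (Fin p), q ^ (symmDiff J J₀).card = (1 + q) ^ p := by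
    have h2 := Fintype.sum_pow_mul_eq_add_pow (Fin p) q 1
    simp only [one_pow, mul_one, Fintype.card_fin] at h2
    rw [add_comm, ← h2]
    exact (Equiv.sum_comp (Function.Involutive.toPerm (fun J => symmDiff J J₀)
      fun J => symmDiff_symmDiff_cancel_right J₀ J) fun D : Finset (Fin p) => q ^ D.card)
  rw [← h1, ← Finset.add_sum_erase univ _ (mem_univ J₀)]
  simp

theorem one_add_rpow_pow_sub_one_le {p : ℕ} (hp : 2 ≤ p) {c : ℝ} (hc : 1 ≤ c) :
    (1 + Real.exp (-(1 + c) * Real.log p)) ^ p - 1 ≤ 2 * (p : ℝ) ^ (-c) := by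
  have hp0 : (0 : ℝ) < p := by positivity
  set q := Real.exp (-(1 + c) * Real.log p) with hq
  have hq0 : 0 < q := Real.exp_pos _
  have hpq : p * q = (p : ℝ) ^ (-c) := by
    rw [Real.rpow_def_of_pos hp0, hq]
    nth_rewrite 1 [← Real.exp_log hp0]
    rw [← Real.exp_add]
    ring_nf
  have hle : (p : ℝ) ^ (-c) ≤ 1 :=
    Real.rpow_le_one_of_one_le_of_nonpos (by exact_mod_cast (by omega : 1 ≤ p)) (by linarith)
  have h1 : (1 + q) ^ p ≤ Real.exp (p * q) := by
    rw [Real.exp_nat_mul]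
    exact pow_le_pow_left₀ (by positivity) (by linarith [Real.add_one_le_exp q]) p
  have h0 : 0 ≤ p * q := by positivity
  have h2 := Real.abs_exp_sub_one_le (x := p * q) (by rw [abs_of_nonneg h0, hpq]; exact hle)
  rw [abs_of_nonneg h0] at h2
  rw [← hpq]
  linarith [le_abs_self (Real.exp (p * q) - 1)]

/-- The log-posterior comparison, as an inequality between real numbers. -/
theorem log_weight_gap_neg {ε c L lam σ s k l m A₁ A₂ R F : ℝ} (hε : 0 < ε) (hc : 1 ≤ c)
    (hL : 0 < L) (hσ : 0 < σ) (hlam : lam = ((1 + ε) / ε) * (23 + 5 * c) * L)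
    (hl : 0 ≤ l) (hm : 0 ≤ m) (hls : l ≤ s) (hmk : m ≤ k) (hks : k - s = m - l)
    (hd : 1 ≤ l + m) (hA₁ : 0 ≤ A₁) (hA : F / 2 - R ≤ A₁)
    (hA₂ : A₂ ≤ σ ^ 2 * ((6 + 4 * c) * (l + m) * L)) (hR : R ≤ σ ^ 2 * ((6 + 4 * c) * (l + m) * L))
    (hF : k ≤ (1 + ε) * s → 9 * σ ^ 2 * lam * l ≤ F) :
    (l + m) * L + lam * (s - k) + (A₂ - A₁) / (2 * σ ^ 2) < 0 := by
  have hσ2 : 0 < 2 * σ ^ 2 := by positivity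
  have hlamL : (23 + 5 * c) * L ≤ lam := by
    rw [hlam, mul_assoc]
    refine le_mul_of_one_le_left (by positivity) ?_
    rw [le_div_iff₀ hε]; linarith
  have hdL : 0 < (l + m) * L := by positivity
  have hcdL : 0 < c * ((l + m) * L) := by positivity
  have hmL := mul_nonneg hm hL.le
  have hlL := mul_nonneg hl hL.le
  by_cases hk : k ≤ (1 + ε) * s
  · have hF' := hF hk
    have h1 : (A₂ - A₁) / (2 * σ ^ 2) ≤ (6 + 4 * c) * (l + m) * L - 9 / 4 * lam * l := by
      rw [div_le_iff₀ hσ2]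
      nlinarith
    have h2 := mul_le_mul_of_nonneg_right hlamL hm
    have h3 := mul_le_mul_of_nonneg_right hlamL hl
    have h4 : s - k = l - m := by linarith
    rw [h4]
    have h5 : 0 ≤ c * (l * L) := by positivity
    have h6 : 0 ≤ c * (m * L) := by positivity
    nlinarith
  · have h1 : (A₂ - A₁) / (2 * σ ^ 2) ≤ (3 + 2 * c) * (l + m) * L := by
      rw [div_le_iff₀ hσ2]
      nlinarith
    have h2 : k * ((23 + 5 * c) * L) ≤ lam * (k - s) := by
      have h3 : ε * k ≤ (1 + ε) * (k - s) := by nlinarith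
      have h4 : lam * (k - s) = ((1 + ε) * (k - s) / ε) * ((23 + 5 * c) * L) := by
        rw [hlam]; ring
      rw [h4]
      refine mul_le_mul_of_nonneg_right ?_ (by positivity)
      rw [le_div_iff₀ hε]; linarith
    have hsk : s ≤ k := by nlinarith
    have h5 : (l + m) ≤ 2 * k := by linarith
    have h6 : (4 + 2 * c) * L * (l + m) ≤ (4 + 2 * c) * L * (2 * k) :=
      mul_le_mul_of_nonneg_left h5 (by positivity)
    have h7 : 0 < k * L := mul_pos (by linarith) hL
    have h8 : 0 < c * (k * L) := by positivity
    nlinarith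

theorem inv_mul_exp_lt {a b t x₁ x₂ y₁ y₂ : ℝ} (ha : 0 < a) (hb : 0 < b)
    (hab : b ≤ a * Real.exp t) (h : t + x₁ + x₂ < y₁ + y₂) :
    a⁻¹ * Real.exp x₁ * Real.exp x₂ < b⁻¹ * Real.exp y₁ * Real.exp y₂ := by
  rw [mul_assoc, mul_assoc, ← Real.exp_add, ← Real.exp_add, inv_mul_lt_iff₀ ha,
    ← mul_assoc, ← div_eq_mul_inv, div_mul_eq_mul_div, lt_div_iff₀ hb]
  calc Real.exp (x₁ + x₂) * b ≤ Real.exp (x₁ + x₂) * (a * Real.exp t) := by gcongr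
    _ = a * Real.exp (t + x₁ + x₂) := by rw [add_assoc t, Real.exp_add t]; ring
    _ < a * Real.exp (y₁ + y₂) := by gcongr

/-- The restricted eigenvalue bound, homogenized. -/
theorem restricted_eigenvalue_le {n p : ℕ} (hn : 1 ≤ n) (X : Matrix (Fin n) (Fin p) ℝ)
    {r s : ℝ} (hr : 0 < r)
    (hnu : r = sInf {r : ℝ | ∃ (J : Finset (Fin p)) (u : Fin p → ℝ),
        (J.card : ℝ) ≤ s ∧ (∀ j ∉ J, u j = 0) ∧ (∑ j, (u j)^2) = 1 ∧
        r = Real.sqrt (∑ i, (X.mulVec u i)^2) / Real.sqrt n})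
    {J : Finset (Fin p)} (hJ : (J.card : ℝ) ≤ s) {u : Fin p → ℝ} (hu : ∀ j ∉ J, u j = 0) :
    n * r ^ 2 * ∑ j, u j ^ 2 ≤ ∑ i, X.mulVec u i ^ 2 := by
  have hn0 : (0 : ℝ) < n := by exact_mod_cast hn
  have hu0 : 0 ≤ ∑ j, u j ^ 2 := Finset.sum_nonneg fun j _ => sq_nonneg _
  rcases hu0.eq_or_lt with h0 | hpos
  · rw [← h0, mul_zero]
    exact Finset.sum_nonneg fun i _ => sq_nonneg _
  set a := √(∑ j, u j ^ 2) with ha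
  have ha0 : 0 < a := Real.sqrt_pos.2 hpos
  have ha2 : a ^ 2 = ∑ j, u j ^ 2 := Real.sq_sqrt hu0
  have hmem : r ≤ √(∑ i, (X.mulVec (a⁻¹ • u) i) ^ 2) / √n := by
    rw [hnu]
    refine csInf_le ⟨0, ?_⟩ ⟨J, a⁻¹ • u, hJ, fun j hj => by simp [hu j hj], ?_, rfl⟩
    · rintro _ ⟨_, _, _, _, _, rfl⟩
      positivity
    · simp only [Pi.smul_apply, smul_eq_mul, mul_pow, ← Finset.mul_sum, ← ha2]
      field_simp
  rw [le_div_iff₀ (Real.sqrt_pos.2 hn0)] at hmem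
  have h2 := pow_le_pow_left₀ (by positivity) hmem 2
  rw [Real.sq_sqrt (Finset.sum_nonneg fun i _ => sq_nonneg _), mul_pow,
    Real.sq_sqrt hn0.le] at h2
  simp only [Matrix.mulVec_smul, Pi.smul_apply, smul_eq_mul, mul_pow, ← Finset.mul_sum] at h2
  rw [inv_pow, ← div_eq_inv_mul, le_div_iff₀ (by positivity), ha2] at h2
  linarith

/-- The span of the columns of `X` indexed by `J`. -/
def columnSpan {n p : ℕ} (X : Matrix (Fin n) (Fin p) ℝ) (J : Finset (Fin p)) :
    Submodule ℝ (EuclideanSpace ℝ (Fin n)) :=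
  Submodule.span ℝ ((fun j => WithLp.toLp 2 fun i => X i j) '' (J : Set (Fin p)))

theorem columnSpan_mono {n p : ℕ} (X : Matrix (Fin n) (Fin p) ℝ) {J J' : Finset (Fin p)}
    (h : J ⊆ J') : columnSpan X J ≤ columnSpan X J' :=
  Submodule.span_mono (Set.image_mono (by exact_mod_cast h))

theorem toLp_mulVec_mem_columnSpan {n p : ℕ} (X : Matrix (Fin n) (Fin p) ℝ)
    {J : Finset (Fin p)} {u : Fin p → ℝ} (hu : ∀ j ∉ J, u j = 0) :
    WithLp.toLp 2 (X.mulVec u) ∈ columnSpan X J := by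
  have h : WithLp.toLp 2 (X.mulVec u)
      = ∑ j, u j • (WithLp.toLp 2 fun i => X i j : EuclideanSpace ℝ (Fin n)) := by
    ext i
    simp [Matrix.mulVec, dotProduct, mul_comm]
  rw [h]
  refine Submodule.sum_mem _ fun j _ => ?_
  by_cases hj : j ∈ J
  · exact Submodule.smul_mem _ _ (Submodule.subset_span ⟨j, hj, rfl⟩)
  · rw [hu j hj, zero_smul]
    exact Submodule.zero_mem _

theorem toLp_eq_starProjection_columnSpan {n p : ℕ} (X : Matrix (Fin n) (Fin p) ℝ)
    {J : Finset (Fin p)} {v w : Fin n → ℝ}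
    (hw : ∃ cf : Fin p → ℝ, (∀ j ∉ J, cf j = 0) ∧ w = X.mulVec cf)
    (ho : ∀ j ∈ J, (∑ i, (v i - w i) * X i j) = 0) :
    (columnSpan X J).starProjection (WithLp.toLp 2 v) = WithLp.toLp 2 w := by
  obtain ⟨cf, hcf, rfl⟩ := hw
  refine Submodule.eq_starProjection_of_mem_of_inner_eq_zero (toLp_mulVec_mem_columnSpan X hcf)
    fun x hx => ?_
  induction hx using Submodule.span_induction with
  | mem x hx =>
    obtain ⟨j, hj, rfl⟩ := hx
    rw [← ho j hj]
    simp [PiLp.inner_apply, mul_comm]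
  | zero => exact inner_zero_right _
  | add a b _ _ ha hb => rw [inner_add_right, ha, hb, add_zero]
  | smul r a _ ha => rw [real_inner_smul_right, ha, mul_zero]

/-- Signal left unexplained by the model `J`, in terms of the number of missed coordinates. -/
theorem signal_sq_norm_ge {n p : ℕ} (hn : 1 ≤ n) (X : Matrix (Fin n) (Fin p) ℝ)
    {r s : ℝ} (hr : 0 < r)
    (hnu : r = sInf {r : ℝ | ∃ (J : Finset (Fin p)) (u : Fin p → ℝ),
        (J.card : ℝ) ≤ s ∧ (∀ j ∉ J, u j = 0) ∧ (∑ j, (u j)^2) = 1 ∧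
        r = Real.sqrt (∑ i, (X.mulVec u i)^2) / Real.sqrt n})
    {J J₀ : Finset (Fin p)} (hJ : ((J ∪ J₀).card : ℝ) ≤ s) {b cf : Fin p → ℝ}
    (hb : ∀ j ∉ J₀, b j = 0) (hcf : ∀ j ∉ J, cf j = 0) {σ lam : ℝ} (hσ : 0 < σ) (hlam : 0 ≤ lam)
    (hbmin : ∀ j ∈ J₀, 3 * σ * √(lam / n) / r ≤ |b j|) :
    9 * σ ^ 2 * lam * (J₀ \ J).card ≤ ∑ i, (X.mulVec b i - X.mulVec cf i) ^ 2 := by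
  have hn0 : (0 : ℝ) < n := by exact_mod_cast hn
  have h1 := restricted_eigenvalue_le hn X hr hnu hJ (u := b - cf) fun j hj => by
    rw [Finset.mem_union, not_or] at hj
    simp [hb j hj.2, hcf j hj.1]
  simp only [Matrix.mulVec_sub, Pi.sub_apply] at h1
  refine le_trans ?_ h1
  have h2 : ((J₀ \ J).card : ℝ) * (3 * σ * √(lam / n) / r) ^ 2 ≤ ∑ j, (b j - cf j) ^ 2 := by
    rw [← nsmul_eq_mul]
    refine (Finset.card_nsmul_le_sum (J₀ \ J) (fun j => (b j - cf j) ^ 2) _ fun j hj => ?_).trans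
      (Finset.sum_le_univ_sum_of_nonneg fun j => sq_nonneg _)
    rw [Finset.mem_sdiff] at hj
    rw [hcf j hj.2, sub_zero, ← sq_abs (b j)]
    exact pow_le_pow_left₀ (by positivity) (hbmin j hj.1) 2
  have h3 : n * r ^ 2 * (((J₀ \ J).card : ℝ) * (3 * σ * √(lam / n) / r) ^ 2)
      = 9 * σ ^ 2 * lam * (J₀ \ J).card := by
    rw [div_pow, mul_pow, mul_pow, Real.sq_sqrt (by positivity)]
    field_simp
    ring
  rw [← h3]
  gcongr

/-- The two noise terms entering the comparison of the model `J` with the model `J₀`. -/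
def noiseExcess {n p : ℕ} (X : Matrix (Fin n) (Fin p) ℝ) (t : ℝ) (J J₀ : Finset (Fin p)) :
    Set (Fin n → ℝ) :=
  {z | t < ‖((columnSpan X J)ᗮ ⊓ columnSpan X (J ∪ J₀)).starProjection (WithLp.toLp 2 z)‖ ^ 2}

theorem measure_noiseExcess_le {n p : ℕ} (X : Matrix (Fin n) (Fin p) ℝ) {σ c : ℝ} (hσ : 0 < σ)
    (hp2 : 2 ≤ p) (J J₀ : Finset (Fin p)) {d : ℕ} (hd : (J₀ \ J).card ≤ d) :
    Measure.pi (fun _ : Fin n => gaussianReal 0 (Real.toNNReal (σ ^ 2)))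
      (noiseExcess X (σ ^ 2 * ((6 + 4 * c) * d * Real.log p)) J J₀)
      ≤ ENNReal.ofReal (Real.exp (-(1 + c) * Real.log p) ^ d) :=
  measure_sq_norm_starProjection_gt hσ _
    ((finrank_orthogonal_inf_span_union _ J J₀).trans hd)
    (Real.log_le_log (by norm_num) (by exact_mod_cast hp2))

theorem measure_iUnion_noiseExcess_le {n p : ℕ} (X : Matrix (Fin n) (Fin p) ℝ) {σ c : ℝ}
    (hσ : 0 < σ) (hp2 : 2 ≤ p) (hc : 1 ≤ c) (J₀ : Finset (Fin p)) :
    Measure.pi (fun _ : Fin n => gaussianReal 0 (Real.toNNReal (σ ^ 2)))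
      (⋃ J ∈ univ.erase J₀,
        noiseExcess X (σ ^ 2 * ((6 + 4 * c) * (symmDiff J J₀).card * Real.log p)) J J₀ ∪
        noiseExcess X (σ ^ 2 * ((6 + 4 * c) * (symmDiff J J₀).card * Real.log p)) J₀ J)
      ≤ ENNReal.ofReal (4 * (p : ℝ) ^ (-c)) := by
  set q := Real.exp (-(1 + c) * Real.log p) with hq
  have hq0 : 0 < q := Real.exp_pos _
  refine (measure_biUnion_finset_le _ _).trans ?_
  calc _ ≤ ∑ J ∈ univ.erase J₀, ENNReal.ofReal (2 * q ^ (symmDiff J J₀).card) := by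
        refine Finset.sum_le_sum fun J _ => (measure_union_le _ _).trans ?_
        rw [two_mul, ENNReal.ofReal_add (by positivity) (by positivity)]
        refine add_le_add (measure_noiseExcess_le X hσ hp2 _ _ (Finset.card_le_card ?_))
          (measure_noiseExcess_le X hσ hp2 _ _ (Finset.card_le_card ?_))
        · exact le_sup_right
        · exact le_sup_left
    _ = ENNReal.ofReal (2 * ((1 + q) ^ p - 1)) := by
        rw [← ENNReal.ofReal_sum_of_nonneg fun J _ => by positivity, ← Finset.mul_sum,
          sum_pow_card_symmDiff]
    _ ≤ _ := by
        refine ENNReal.ofReal_le_ofReal ?_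
        linarith [one_add_rpow_pow_sub_one_le hp2 hc]

theorem ofReal_one_sub_le_measure {Ω : Type*} [MeasurableSpace Ω] (μ : Measure Ω)
    [IsProbabilityMeasure μ] {A B : Set Ω} {r : ℝ} (hr : 0 ≤ r) (hB : μ B ≤ ENNReal.ofReal r)
    (hAB : Bᶜ ⊆ A) : ENNReal.ofReal (1 - r) ≤ μ A := by
  rw [ENNReal.ofReal_sub 1 hr, ENNReal.ofReal_one, tsub_le_iff_right]
  calc 1 = μ Set.univ := measure_univ.symm
    _ ≤ μ (A ∪ B) := measure_mono fun z _ => by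
        by_cases hz : z ∈ B
        · exact Or.inr hz
        · exact Or.inl (hAB hz)
    _ ≤ μ A + μ B := measure_union_le _ _
    _ ≤ μ A + ENNReal.ofReal r := by gcongr

theorem stmt16
    (n p : ℕ) (hn : 1 ≤ n) (hnp : n ≤ p) (hp2 : 2 ≤ p)
    (X : Matrix (Fin n) (Fin p) ℝ)
    (hX : ∀ j, Real.sqrt (∑ i, (X i j)^2) = Real.sqrt n)
    (σ : ℝ) (hσ : 0 < σ)
    (βs : Fin p → ℝ) (sstar : ℕ) (hs1 : 1 ≤ sstar)
    (Jstar : Finset (Fin p)) (hJstar : Jstar = Finset.univ.filter (fun j => βs j ≠ 0))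
    (hcard : Jstar.card = sstar)
    (P : Finset (Fin p) → (Fin n → ℝ) → (Fin n → ℝ))
    (hP : ∀ (J : Finset (Fin p)) (v : Fin n → ℝ),
        (∃ cf : Fin p → ℝ, (∀ j ∉ J, cf j = 0) ∧ P J v = X.mulVec cf)
        ∧ ∀ j ∈ J, (∑ i, (v i - P J v i) * X i j) = 0)
    (μ : Measure (Fin n → ℝ))
    (hμ : μ = Measure.pi (fun _ : Fin n => gaussianReal 0 (Real.toNNReal (σ^2))))
    (hminimal : ∀ b : Fin p → ℝ, X.mulVec b = X.mulVec βs →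
        sstar ≤ (Finset.univ.filter (fun j => b j ≠ 0)).card)
    (y : (Fin n → ℝ) → Fin n → ℝ)
    (hy : ∀ z i, y z i = X.mulVec βs i + z i)
    (sbar : ℕ) (hsbar1 : sstar ≤ sbar) (hsbar2 : sbar ≤ p)
    (lam : ℝ)
    (w Post : (Fin n → ℝ) → Finset (Fin p) → ℝ)
    (hw : ∀ z J, w z J = if J.card ≤ sbar then
        ((p.choose J.card : ℝ))⁻¹ * Real.exp (-(lam * (J.card : ℝ)))
          * Real.exp (-(∑ i, (y z i - P J (y z) i)^2) / (2 * σ^2)) else 0)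
    (hPost : ∀ z J, Post z J = w z J / ∑ J' : Finset (Fin p), w z J')
    (nu : ℝ → ℝ)
    (hnu : ∀ s : ℝ, nu s = sInf {r : ℝ | ∃ (J : Finset (Fin p)) (u : Fin p → ℝ),
        (J.card : ℝ) ≤ s ∧ (∀ j ∉ J, u j = 0) ∧ (∑ j, (u j)^2) = 1 ∧
        r = Real.sqrt (∑ i, (X.mulVec u i)^2) / Real.sqrt n})
    (ε c : ℝ) (hε : 0 < ε) (hc : 1 ≤ c)
    (hI : 0 < nu ((2 + ε) * (sstar : ℝ)))
    (hlam : lam = ((1 + ε) / ε) * (23 + 5 * c) * Real.log p)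
    (hbmin : ∀ j ∈ Jstar,
        3 * σ * Real.sqrt (lam / n) / nu ((2 + ε) * (sstar : ℝ)) ≤ |βs j|)
    :
    ENNReal.ofReal (1 - 6 * (p : ℝ) ^ (-c)) ≤
      μ {z | ∀ J : Finset (Fin p), J ≠ Jstar → Post z J < Post z Jstar} := by
  subst hμ
  have hp0 : (0 : ℝ) < p := by positivity
  have hL : 0 < Real.log p := Real.log_pos (by exact_mod_cast (by omega : 1 < p))
  have hlam0 : 0 ≤ lam := by rw [hlam]; positivity
  have hb : ∀ j ∉ Jstar, βs j = 0 := fun j hj => by simpa [hJstar] using hj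
  have hproj : ∀ J v, (columnSpan X J).starProjection (WithLp.toLp 2 v) = WithLp.toLp 2 (P J v) :=
    fun J v => toLp_eq_starProjection_columnSpan X (hP J v).1 (hP J v).2
  have hres : ∀ J v, ∑ i, (v i - P J v i) ^ 2
      = ‖WithLp.toLp 2 v - (columnSpan X J).starProjection (WithLp.toLp 2 v)‖ ^ 2 := fun J v => by
    rw [hproj, EuclideanSpace.real_norm_sq_eq]
    rfl
  have hBound := measure_iUnion_noiseExcess_le X hσ hp2 hc Jstar
  refine ofReal_one_sub_le_measure _ (by positivity) (hBound.trans
    (ENNReal.ofReal_le_ofReal (by gcongr; norm_num))) fun z hz J hJ => ?_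
  have hchoose : ∀ J : Finset (Fin p), (0 : ℝ) < p.choose J.card := fun J => by
    exact_mod_cast Nat.choose_pos (by simpa using Finset.card_le_univ J)
  have hw0 : ∀ J', 0 ≤ w z J' := fun J' => by rw [hw]; split_ifs <;> positivity
  have hwstar : 0 < w z Jstar := by
    rw [hw, if_pos (by omega)]
    have := hchoose Jstar
    positivity
  rw [hPost, hPost]
  refine div_lt_div_of_pos_right ?_ 
    (Finset.sum_pos' (fun J' _ => hw0 J') ⟨Jstar, mem_univ _, hwstar⟩)
  by_cases hcardJ : J.card ≤ sbar
  swap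
  · rw [hw z J, if_neg hcardJ]
    exact hwstar
  rw [hw, hw, if_pos hcardJ, if_pos (by omega), hres, hres]
  have hd : (symmDiff J Jstar).card = (Jstar \ J).card + (J \ Jstar).card := by
    rw [symmDiff_def, Finset.sup_eq_union, Finset.card_union_of_disjoint disjoint_sdiff_sdiff,
      add_comm]
  have hcJ := Finset.card_sdiff_add_card_inter J Jstar
  have hcS := Finset.card_sdiff_add_card_inter Jstar J
  rw [Finset.inter_comm] at hcS
  have hd1 : 1 ≤ (symmDiff J Jstar).card := by
    rw [Finset.one_le_card, Finset.nonempty_iff_ne_empty]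
    exact fun h => hJ (symmDiff_eq_bot.1 h)
  simp only [Set.mem_compl_iff, Set.mem_iUnion, not_exists, Set.mem_union, not_or] at hz
  obtain ⟨hz₁, hz₂⟩ := hz J (Finset.mem_erase.2 ⟨hJ, mem_univ _⟩)
  simp only [noiseExcess, Set.mem_ofPred_eq, not_lt, hd, Nat.cast_add] at hz₁ hz₂
  simp only [Finset.union_comm Jstar J] at hz₂
  set f : EuclideanSpace ℝ (Fin n) := WithLp.toLp 2 (X.mulVec βs) with hf
  set ζ : EuclideanSpace ℝ (Fin n) := WithLp.toLp 2 z with hζ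
  have hyz : WithLp.toLp 2 (y z) = f + ζ := by
    ext i
    simp [hy, hf, hζ]
  have hfS : f ∈ columnSpan X Jstar := toLp_mulVec_mem_columnSpan X hb
  have hfQ : f ∈ columnSpan X (J ∪ Jstar) := columnSpan_mono X subset_union_right hfS
  have hgap₁ := sq_norm_sub_starProjection
    (columnSpan_mono X (subset_union_left : J ⊆ J ∪ Jstar)) (f + ζ)
  have hgap₂ := sq_norm_sub_starProjection
    (columnSpan_mono X (subset_union_right : Jstar ⊆ J ∪ Jstar)) (f + ζ)
  rw [starProjection_orthogonal_inf_add_of_mem _ hfS] at hgap₂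
  have hsignal : (J.card : ℝ) ≤ (1 + ε) * sstar → 9 * σ ^ 2 * lam * (Jstar \ J).card
      ≤ ‖((columnSpan X J)ᗮ ⊓ columnSpan X (J ∪ Jstar)).starProjection f‖ ^ 2 := fun hk => by
    obtain ⟨cf, hcf, hPf⟩ := (hP J (X.mulVec βs)).1
    rw [starProjection_orthogonal_inf (columnSpan_mono X subset_union_left),
      Submodule.starProjection_eq_self_iff.2 hfQ, ← hres, hPf]
    refine signal_sq_norm_ge hn X hI (hnu _) ?_ hb hcf hσ hlam0 hbmin
    have : ((J ∪ Jstar).card : ℝ) ≤ J.card + Jstar.card := by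
      exact_mod_cast Finset.card_union_le J Jstar
    rw [hcard] at this
    linarith
  have hsplit := sq_norm_add_ge
    (((columnSpan X J)ᗮ ⊓ columnSpan X (J ∪ Jstar)).starProjection f)
    (((columnSpan X J)ᗮ ⊓ columnSpan X (J ∪ Jstar)).starProjection ζ)
  rw [← map_add] at hsplit
  have hneg := log_weight_gap_neg (s := sstar) (k := J.card) hε hc hL hσ hlam
    (Nat.cast_nonneg (Jstar \ J).card) (Nat.cast_nonneg (J \ Jstar).card)
    (by exact_mod_cast (by omega)) (by exact_mod_cast (by omega))
    (by
      rw [← hcard, ← hcJ, ← hcS]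
      push_cast
      ring)
    (by exact_mod_cast (by omega)) (sq_nonneg _) hsplit hz₂ hz₁ hsignal
  rw [hyz, hgap₁, hgap₂]
  refine inv_mul_exp_lt (t := ((Jstar \ J).card + (J \ Jstar).card) * Real.log p) (hchoose J)
    (hchoose Jstar) ?_ ?_
  · have h := choose_le_choose_mul_pow (p := p) (k := J.card) (s := Jstar.card)
      (d := (Jstar \ J).card + (J \ Jstar).card) (by omega)
      (by simpa using Finset.card_le_univ J) (by omega) (by omega)
    rw [← Nat.cast_add, Real.exp_nat_mul, Real.exp_log hp0]
    exact_mod_cast h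
  · rw [hcard]
    rw [sub_div] at hneg
    simp only [neg_div, add_div]
    linarith
end

section
/- Let s ≥ 1 and suppose ν_s > 0. Then for every subset J ⊆ {1,…,p} with |J ∪ J⋆| ≤ s: ‖P_J^⊥(Xβ⋆)‖₂ ≥ √n·ν_s·‖(β⋆)_{J⋆∖J}‖₂, where (β⋆)_{J⋆∖J} is the restriction of β⋆ to the coordinates in J⋆∖J; in particular, ‖P_J^⊥(Xβ⋆)‖₂ ≥ √n·ν_s·√(|J⋆∖J|)·min_{j ∈ J⋆}|β⋆_j|. -/
open MeasureTheory ProbabilityTheory Finset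
open scoped Classical ENNReal

/-- A lower bound for the sparse singular values scales to all vectors supported on a small set. -/
lemma sqrt_mul_sInf_mul_norm_le {n p : ℕ} (X : Matrix (Fin n) (Fin p) ℝ) (s : ℝ)
    (J : Finset (Fin p)) (hJ : (J.card : ℝ) ≤ s) (w : Fin p → ℝ) (hw : ∀ j ∉ J, w j = 0) :
    Real.sqrt n * sInf {r : ℝ | ∃ (J : Finset (Fin p)) (u : Fin p → ℝ),
        (J.card : ℝ) ≤ s ∧ (∀ j ∉ J, u j = 0) ∧ (∑ j, (u j)^2) = 1 ∧
        r = Real.sqrt (∑ i, (X.mulVec u i)^2) / Real.sqrt n} * Real.sqrt (∑ j, (w j)^2)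
      ≤ Real.sqrt (∑ i, (X.mulVec w i)^2) := by
  have hW0 : 0 ≤ ∑ j, (w j)^2 := Finset.sum_nonneg fun j _ => sq_nonneg _
  rcases hW0.eq_or_lt with h0 | hWpos
  · rw [← h0, Real.sqrt_zero, mul_zero]
    exact Real.sqrt_nonneg _
  rcases Nat.eq_zero_or_pos n with rfl | hn
  · simp
  set W := Real.sqrt (∑ j, (w j)^2) with hW
  have hWp : 0 < W := Real.sqrt_pos.2 hWpos
  have hsq : W ^ 2 = ∑ j, (w j)^2 := Real.sq_sqrt hW0
  have hnp : 0 < Real.sqrt n := Real.sqrt_pos.2 (by exact_mod_cast hn)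
  have hscale : Real.sqrt (∑ i, (X.mulVec (W⁻¹ • w) i)^2)
      = W⁻¹ * Real.sqrt (∑ i, (X.mulVec w i)^2) := by
    simp only [Matrix.mulVec_smul, Pi.smul_apply, smul_eq_mul, mul_pow]
    rw [← Finset.mul_sum, Real.sqrt_mul (sq_nonneg _), Real.sqrt_sq (inv_nonneg.2 hWp.le)]
  have hunit : ∑ j, ((W⁻¹ • w) j)^2 = 1 := by
    simp only [Pi.smul_apply, smul_eq_mul, mul_pow]
    rw [← Finset.mul_sum, ← hsq]
    field_simp
  have hle : sInf {r : ℝ | ∃ (J : Finset (Fin p)) (u : Fin p → ℝ),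
        (J.card : ℝ) ≤ s ∧ (∀ j ∉ J, u j = 0) ∧ (∑ j, (u j)^2) = 1 ∧
        r = Real.sqrt (∑ i, (X.mulVec u i)^2) / Real.sqrt n}
      ≤ W⁻¹ * Real.sqrt (∑ i, (X.mulVec w i)^2) / Real.sqrt n := by
    refine csInf_le ⟨0, ?_⟩ ⟨J, W⁻¹ • w, hJ, fun j hj => by simp [hw j hj], hunit, ?_⟩
    · rintro r ⟨_, _, _, _, _, rfl⟩
      positivity
    · rw [hscale]
  rw [le_div_iff₀ hnp, inv_mul_eq_div, le_div_iff₀ hWp] at hle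
  linarith

theorem stmt17
    (n p : ℕ)
    (X : Matrix (Fin n) (Fin p) ℝ)
    (βs : Fin p → ℝ) (sstar : ℕ) (hs1 : 1 ≤ sstar)
    (Jstar : Finset (Fin p)) (hJstar : Jstar = Finset.univ.filter (fun j => βs j ≠ 0))
    (hcard : Jstar.card = sstar) (hne : Jstar.Nonempty)
    (P : Finset (Fin p) → (Fin n → ℝ) → (Fin n → ℝ))
    (hP : ∀ (J : Finset (Fin p)) (v : Fin n → ℝ),
        (∃ cf : Fin p → ℝ, (∀ j ∉ J, cf j = 0) ∧ P J v = X.mulVec cf)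
        ∧ ∀ j ∈ J, (∑ i, (v i - P J v i) * X i j) = 0)
    (nu : ℝ → ℝ)
    (hnu : ∀ s : ℝ, nu s = sInf {r : ℝ | ∃ (J : Finset (Fin p)) (u : Fin p → ℝ),
        (J.card : ℝ) ≤ s ∧ (∀ j ∉ J, u j = 0) ∧ (∑ j, (u j)^2) = 1 ∧
        r = Real.sqrt (∑ i, (X.mulVec u i)^2) / Real.sqrt n})
    (s : ℝ) (hs : 1 ≤ s) (hnus : 0 < nu s)
    :
    ∀ J : Finset (Fin p), ((J ∪ Jstar).card : ℝ) ≤ s →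
      Real.sqrt n * nu s * Real.sqrt (∑ j ∈ Jstar \ J, (βs j)^2)
          ≤ Real.sqrt (∑ i, (X.mulVec βs i - P J (X.mulVec βs) i)^2)
      ∧ Real.sqrt n * nu s * Real.sqrt (((Jstar \ J).card : ℝ))
            * (Jstar.inf' hne fun j => |βs j|)
          ≤ Real.sqrt (∑ i, (X.mulVec βs i - P J (X.mulVec βs) i)^2) := by
  intro J hJ
  obtain ⟨⟨cf, hcf, hPcf⟩, -⟩ := hP J (X.mulVec βs)
  have hsupp : ∀ j ∉ J ∪ Jstar, (βs - cf) j = 0 := by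
    intro j hj
    simp only [Finset.mem_union, not_or] at hj
    have hb : βs j = 0 := by simpa [hJstar] using hj.2
    simp [hb, hcf j hj.1]
  have hmain := sqrt_mul_sInf_mul_norm_le X s (J ∪ Jstar) hJ (βs - cf) hsupp
  rw [← hnu] at hmain
  have hres : ∑ i, (X.mulVec (βs - cf) i)^2
      = ∑ i, (X.mulVec βs i - P J (X.mulVec βs) i)^2 := by
    rw [hPcf, Matrix.mulVec_sub]
    rfl
  rw [hres] at hmain
  have hsum : ∑ j ∈ Jstar \ J, (βs j)^2 ≤ ∑ j, ((βs - cf) j)^2 := by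
    calc ∑ j ∈ Jstar \ J, (βs j)^2 = ∑ j ∈ Jstar \ J, ((βs - cf) j)^2 :=
          Finset.sum_congr rfl fun j hj => by simp [hcf j (Finset.mem_sdiff.1 hj).2]
      _ ≤ ∑ j, ((βs - cf) j)^2 :=
          Finset.sum_le_sum_of_subset_of_nonneg (Finset.subset_univ _) fun j _ _ => sq_nonneg _
  have hfirst : Real.sqrt n * nu s * Real.sqrt (∑ j ∈ Jstar \ J, (βs j)^2)
      ≤ Real.sqrt (∑ i, (X.mulVec βs i - P J (X.mulVec βs) i)^2) :=
    le_trans (by gcongr) hmain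
  refine ⟨hfirst, le_trans ?_ hfirst⟩
  have hm0 : 0 ≤ Jstar.inf' hne fun j => |βs j| :=
    Finset.le_inf' hne _ fun j _ => abs_nonneg _
  rw [mul_assoc]
  refine mul_le_mul_of_nonneg_left (Real.le_sqrt_of_sq_le ?_) (by positivity)
  rw [mul_pow, Real.sq_sqrt (Nat.cast_nonneg _), ← nsmul_eq_mul]
  refine Finset.card_nsmul_le_sum _ _ _ fun j hj => ?_
  rw [← sq_abs (βs j)]
  exact pow_le_pow_left₀ hm0 (Finset.inf'_le _ (Finset.mem_sdiff.1 hj).1) 2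
end

section
/- For any c > 0, with probability at least 1 − 2p^(−c) over the Gaussian noise z, simultaneously for every subset J ⊆ {1,…,p} with J ≠ J⋆, writing s = |J| and t = |J ∩ J⋆|: y^⊤(P_J − P_{J⋆})y ≤ (40 + 8c)·σ²·(max(s, s⋆) − t)·log p − (1/2)·‖P_J^⊥(Xβ⋆)‖₂². -/
open MeasureTheory ProbabilityTheory Finset
open scoped Classical ENNReal

lemma lintegral_pi_prod_ofReal {ι : Type*} [Fintype ι] (ν : Measure ℝ) [IsProbabilityMeasure ν]
    (f : ι → ℝ → ℝ) (hf : ∀ i x, 0 ≤ f i x) (hfi : ∀ i, Integrable (f i) ν) :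
    ∫⁻ x, ENNReal.ofReal (∏ i, f i (x i)) ∂(Measure.pi fun _ : ι => ν)
      = ENNReal.ofReal (∏ i, ∫ x, f i x ∂ν) := by
  rw [← integral_fintype_prod_eq_prod, ofReal_integral_eq_lintegral_ofReal]
  · exact Integrable.fintype_prod hfi
  · exact Filter.Eventually.of_forall fun x => Finset.prod_nonneg fun i _ => hf i _

lemma lintegral_exp_linear_pi_gaussianReal {ι : Type*} [Fintype ι] (v : NNReal) (a : ι → ℝ) :
    ∫⁻ z, ENNReal.ofReal (Real.exp (∑ i, a i * z i))
        ∂(Measure.pi fun _ : ι => gaussianReal 0 v)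
      = ENNReal.ofReal (Real.exp (v / 2 * ∑ i, a i ^ 2)) := by
  simp_rw [Real.exp_sum]
  rw [lintegral_pi_prod_ofReal (gaussianReal 0 v) (fun i x => Real.exp (a i * x))
    (fun i x => (Real.exp_pos _).le) (fun i => integrable_exp_mul_gaussianReal (a i)),
    Finset.mul_sum, Real.exp_sum]
  congr 1
  refine Finset.prod_congr rfl fun i _ => ?_
  have h := congrFun (mgf_fun_id_gaussianReal (μ := 0) (v := v)) (a i)
  simp only [mgf] at h
  rw [h]
  ring_nf

lemma exp_sq_gaussianReal {w : NNReal} (hw : w ≠ 0) :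
    Integrable (fun x => Real.exp ((4 * w : ℝ)⁻¹ * x ^ 2)) (gaussianReal 0 w) ∧
      ∫ x, Real.exp ((4 * w : ℝ)⁻¹ * x ^ 2) ∂(gaussianReal 0 w) = √2 := by
  have hw' : (0 : ℝ) < w := by positivity
  have key : ∀ x : ℝ, gaussianPDFReal 0 w x * Real.exp ((4 * w : ℝ)⁻¹ * x ^ 2)
      = (√(2 * Real.pi * w))⁻¹ * Real.exp (-(4 * w : ℝ)⁻¹ * x ^ 2) := by
    intro x
    rw [gaussianPDFReal, mul_assoc, ← Real.exp_add]
    congr 2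
    field_simp
    ring
  have hb : (0 : ℝ) < (4 * w : ℝ)⁻¹ := by positivity
  constructor
  · rw [gaussianReal_of_var_ne_zero 0 hw,
      integrable_withDensity_iff_integrable_smul' (by fun_prop)
        (Filter.Eventually.of_forall fun x => by simp [gaussianPDF])]
    refine ((integrable_exp_neg_mul_sq hb).const_mul (√(2 * Real.pi * w))⁻¹).congr
      (Filter.Eventually.of_forall fun x => ?_)
    simp only [gaussianPDF, ENNReal.toReal_ofReal (gaussianPDFReal_nonneg 0 w x), smul_eq_mul]
    exact (key x).symm
  · rw [integral_gaussianReal_eq_integral_smul hw]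
    simp_rw [smul_eq_mul, key]
    rw [integral_const_mul, integral_gaussian, inv_mul_eq_div, ← Real.sqrt_div' _ (by positivity)]
    congr 1
    field_simp
    norm_num

lemma lintegral_exp_sq_pi_gaussianReal {ι : Type*} [Fintype ι] {w : NNReal} (hw : w ≠ 0) :
    ∫⁻ x, ENNReal.ofReal (Real.exp ((4 * w : ℝ)⁻¹ * ∑ i, x i ^ 2))
        ∂(Measure.pi fun _ : ι => gaussianReal 0 w)
      = ENNReal.ofReal (√2 ^ Fintype.card ι) := by
  simp_rw [Finset.mul_sum, Real.exp_sum]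
  rw [lintegral_pi_prod_ofReal (gaussianReal 0 w) (fun _ x => Real.exp ((4 * w : ℝ)⁻¹ * x ^ 2))
    (fun i x => (Real.exp_pos _).le) (fun i => (exp_sq_gaussianReal hw).1)]
  rw [(exp_sq_gaussianReal hw).2, Finset.prod_const, Finset.card_univ]

/-- The Gaussian square is decoupled through an auxiliary Gaussian vector `ξ`, which avoids any
change of orthonormal basis. -/
lemma lintegral_exp_sum_sq_inner {n d : ℕ} {v : NNReal} (hv : v ≠ 0)
    (u : Fin d → EuclideanSpace ℝ (Fin n)) (hu : Orthonormal ℝ u) :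
    ∫⁻ z, ENNReal.ofReal (Real.exp ((4 * v : ℝ)⁻¹ * ∑ i, inner ℝ (u i) (WithLp.toLp 2 z) ^ 2))
        ∂(Measure.pi fun _ : Fin n => gaussianReal 0 v)
      = ENNReal.ofReal (√2 ^ d) := by
  set w : NNReal := (2 * v)⁻¹ with hw
  have hw0 : w ≠ 0 := by simp [hw, hv]
  have hv' : (v : ℝ) ≠ 0 := by exact_mod_cast hv
  have h1 : ∀ z : Fin n → ℝ,
      ENNReal.ofReal (Real.exp ((4 * v : ℝ)⁻¹ * ∑ i, inner ℝ (u i) (WithLp.toLp 2 z) ^ 2))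
      = ∫⁻ ξ, ENNReal.ofReal (Real.exp (∑ i, inner ℝ (u i) (WithLp.toLp 2 z) * ξ i))
        ∂(Measure.pi fun _ : Fin d => gaussianReal 0 w) := by
    intro z
    rw [lintegral_exp_linear_pi_gaussianReal]
    congr 3
    rw [hw]
    push_cast
    field_simp
    norm_num
  have h2 : ∀ ξ : Fin d → ℝ,
      ∫⁻ z, ENNReal.ofReal (Real.exp (∑ i, inner ℝ (u i) (WithLp.toLp 2 z) * ξ i))
        ∂(Measure.pi fun _ : Fin n => gaussianReal 0 v)
      = ENNReal.ofReal (Real.exp ((4 * w : ℝ)⁻¹ * ∑ i, ξ i ^ 2)) := by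
    intro ξ
    set a : EuclideanSpace ℝ (Fin n) := ∑ i, ξ i • u i with ha
    have e1 : ∀ z : Fin n → ℝ, ∑ i, inner ℝ (u i) (WithLp.toLp 2 z) * ξ i = ∑ k, a k * z k := by
      intro z
      have : inner ℝ a (WithLp.toLp 2 z) = ∑ k, a k * z k := by
        simp [PiLp.inner_apply, mul_comm]
      rw [← this, ha, sum_inner]
      refine Finset.sum_congr rfl fun i _ => ?_
      rw [real_inner_smul_left, mul_comm]
    have e2 : ∑ k, a k ^ 2 = ∑ i, ξ i ^ 2 := by
      rw [← EuclideanSpace.real_norm_sq_eq, ← real_inner_self_eq_norm_sq, ha, hu.inner_sum]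
      simp [sq]
    simp_rw [e1]
    rw [lintegral_exp_linear_pi_gaussianReal, e2]
    congr 3
    rw [hw]
    push_cast
    field_simp
    norm_num
  simp_rw [h1]
  rw [lintegral_lintegral_swap]
  · simp_rw [h2]
    rw [lintegral_exp_sq_pi_gaussianReal hw0, Fintype.card_fin]
  · refine Measurable.aemeasurable (Continuous.measurable ?_)
    refine ENNReal.continuous_ofReal.comp (Real.continuous_exp.comp ?_)
    refine continuous_finsetSum _ fun i _ => ?_
    refine Continuous.mul (Continuous.inner continuous_const
      ((PiLp.continuous_toLp 2 _).comp continuous_fst)) ?_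
    exact (continuous_apply i).comp continuous_snd

lemma measure_le_norm_sq_starProjection_le {n : ℕ} {v : NNReal} (hv : v ≠ 0)
    (V : Submodule ℝ (EuclideanSpace ℝ (Fin n))) (x : ℝ) :
    (Measure.pi fun _ : Fin n => gaussianReal 0 v)
        {z | x ≤ (4 * v : ℝ)⁻¹ * ‖V.starProjection (WithLp.toLp 2 z)‖ ^ 2}
      ≤ ENNReal.ofReal (√2 ^ (Module.finrank ℝ V) * Real.exp (-x)) := by
  set b := stdOrthonormalBasis ℝ V
  have hu : Orthonormal ℝ (fun i => (b i : EuclideanSpace ℝ (Fin n))) :=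
    b.orthonormal.comp_linearIsometry V.subtypeₗᵢ
  have hnorm : ∀ y : EuclideanSpace ℝ (Fin n), ‖V.starProjection y‖ ^ 2
      = ∑ i, inner ℝ (b i : EuclideanSpace ℝ (Fin n)) y ^ 2 := by
    intro y
    have h := b.sum_sq_norm_inner_right (V.orthogonalProjectionOnto y)
    rw [Submodule.starProjection_apply, ← Submodule.coe_norm, ← h]
    refine Finset.sum_congr rfl fun i _ => ?_
    simp
  simp_rw [hnorm]
  have hm : Measurable fun z : Fin n → ℝ => ENNReal.ofReal (Real.exp ((4 * v : ℝ)⁻¹ *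
      ∑ i, inner ℝ (b i : EuclideanSpace ℝ (Fin n)) (WithLp.toLp 2 z) ^ 2)) := by
    refine Continuous.measurable (ENNReal.continuous_ofReal.comp (Real.continuous_exp.comp ?_))
    refine continuous_const.mul (continuous_finsetSum _ fun i _ => ?_)
    exact (Continuous.inner continuous_const (PiLp.continuous_toLp 2 _)).pow 2
  have h := meas_ge_le_lintegral_div (μ := Measure.pi fun _ : Fin n => gaussianReal 0 v)
    hm.aemeasurable (ε := ENNReal.ofReal (Real.exp x)) (by simp [Real.exp_pos]) (by simp)
  rw [lintegral_exp_sum_sq_inner hv _ hu, ← ENNReal.ofReal_div_of_pos (Real.exp_pos x)] at h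
  rw [Real.exp_neg, ← div_eq_mul_inv]
  refine le_trans (measure_mono fun z hz => ?_) h
  exact ENNReal.ofReal_le_ofReal (Real.exp_le_exp.2 hz)

lemma inner_starProjection_sub_le {E : Type*} [NormedAddCommGroup E] [InnerProductSpace ℝ E]
    [FiniteDimensional ℝ E] {U S K V : Submodule ℝ E} (hKU : K ≤ U) (hKS : K ≤ S) {m z : E}
    (hm : m ∈ S) (hmV : m - U.starProjection m ∈ V)
    (hzV : U.starProjection z - K.starProjection z ∈ V) :
    inner ℝ (m + z) (U.starProjection (m + z) - S.starProjection (m + z))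
      ≤ 2 * ‖V.starProjection z‖ ^ 2 - 1 / 2 * ‖m - U.starProjection m‖ ^ 2 := by
  have hSm : S.starProjection m = m := Submodule.starProjection_eq_self_iff.2 hm
  have hself : ∀ (W : Submodule ℝ E) (x : E),
      inner ℝ x (W.starProjection x) = ‖W.starProjection x‖ ^ 2 := by
    intro W x
    have := W.starProjection_inner_eq_zero x _ (W.starProjection_apply_mem x)
    rw [inner_sub_left, real_inner_self_eq_norm_sq] at this
    linarith
  have hperp : ∀ x, inner ℝ (m - U.starProjection m) (U.starProjection x) = 0 := fun x =>
    U.starProjection_inner_eq_zero m _ (U.starProjection_apply_mem x)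
  set a := m - U.starProjection m with ha
  set w := U.starProjection z - K.starProjection z with hw
  set q := V.starProjection z with hq
  have hVz : ∀ x ∈ V, inner ℝ x z = inner ℝ x q := by
    intro x hx
    have := V.starProjection_inner_eq_zero z x hx
    rw [real_inner_comm, inner_sub_right] at this
    linarith
  have haw : inner ℝ a w = 0 :=
    U.starProjection_inner_eq_zero m _
      (U.sub_mem (U.starProjection_apply_mem z) (hKU (K.starProjection_apply_mem z)))
  have hKUz : inner ℝ (U.starProjection z) (K.starProjection z) = ‖K.starProjection z‖ ^ 2 := by
    have := U.starProjection_inner_eq_zero z _ (hKU (K.starProjection_apply_mem z))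
    rw [inner_sub_left, hself] at this
    linarith
  have hww : ‖w‖ ^ 2 = inner ℝ w z := by
    rw [hw, norm_sub_sq_real, inner_sub_left, hKUz, real_inner_comm, hself, real_inner_comm,
      hself]
    ring
  have hKSz : ‖K.starProjection z‖ ^ 2 ≤ ‖S.starProjection z‖ ^ 2 := by
    have h1 := S.starProjection_inner_eq_zero z _ (hKS (K.starProjection_apply_mem z))
    rw [inner_sub_left, hself] at h1
    have h2 := norm_sub_sq_real (S.starProjection z) (K.starProjection z)
    nlinarith [sq_nonneg ‖S.starProjection z - K.starProjection z‖]
  have hcs : ‖w‖ ^ 2 ≤ ‖q + (1 / 2 : ℝ) • a‖ ^ 2 := by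
    have h1 : inner ℝ w (q + (1 / 2 : ℝ) • a) = ‖w‖ ^ 2 := by
      rw [inner_add_right, real_inner_smul_right, real_inner_comm a w, haw, ← hVz w hzV, hww]
      ring
    have h2 := norm_sub_sq_real (q + (1 / 2 : ℝ) • a) w
    rw [real_inner_comm, h1] at h2
    nlinarith [sq_nonneg ‖q + (1 / 2 : ℝ) • a - w‖]
  have hexp : ‖q + (1 / 2 : ℝ) • a‖ ^ 2 = ‖q‖ ^ 2 + inner ℝ a z + 1 / 4 * ‖a‖ ^ 2 := by
    rw [norm_add_sq_real, real_inner_smul_right, real_inner_comm, ← hVz a hmV, norm_smul]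
    norm_num
    ring
  have hmain : inner ℝ (m + z) (U.starProjection (m + z) - S.starProjection (m + z))
      = - ‖a‖ ^ 2 - 2 * inner ℝ a z + (‖w‖ ^ 2 + ‖K.starProjection z‖ ^ 2)
        - ‖S.starProjection z‖ ^ 2 := by
    have e1 : inner ℝ m (U.starProjection z) = inner ℝ (U.starProjection m) z :=
      (U.inner_starProjection_left_eq_right m z).symm
    have e2 : inner ℝ m (S.starProjection z) = inner ℝ m z := by
      rw [← S.inner_starProjection_left_eq_right, hSm]
    have e3 : ‖a‖ ^ 2 = ‖m‖ ^ 2 - ‖U.starProjection m‖ ^ 2 := by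
      rw [ha, norm_sub_sq_real, hself]
      ring
    have e4 : inner ℝ a z = inner ℝ m z - inner ℝ (U.starProjection m) z := by
      rw [ha, inner_sub_left]
    have e5 : ‖w‖ ^ 2 = ‖U.starProjection z‖ ^ 2 - ‖K.starProjection z‖ ^ 2 := by
      rw [hw, norm_sub_sq_real, hKUz]
      ring
    simp only [map_add, inner_sub_right, inner_add_left, inner_add_right, hSm, hself, e1, e2,
      e3, e4, e5, real_inner_self_eq_norm_sq]
    rw [real_inner_comm (U.starProjection m) z, real_inner_comm m z]
    ring
  rw [hmain]
  nlinarith [hcs, hexp, hKSz]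

lemma exists_submodule_finrank_le {E ι : Type*} [DecidableEq ι] [NormedAddCommGroup E]
    [InnerProductSpace ℝ E] [FiniteDimensional ℝ E] (x : ι → E) {K J : Finset ι} (hKJ : K ⊆ J) (a : E) :
    ∃ V : Submodule ℝ E, a ∈ V ∧
      (∀ z, (Submodule.span ℝ (x '' J)).starProjection z
        - (Submodule.span ℝ (x '' K)).starProjection z ∈ V) ∧
      Module.finrank ℝ V ≤ (J \ K).card + 1 := by
  set U := Submodule.span ℝ (x '' J)
  set W := Submodule.span ℝ (x '' K)
  have hWU : W ≤ U := Submodule.span_mono (Set.image_mono (by exact_mod_cast hKJ))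
  let T : Finset E := insert a ((J \ K).image fun j => x j - W.starProjection (x j))
  refine ⟨Submodule.span ℝ (T : Set E), Submodule.subset_span (by simp [T]), fun z => ?_, ?_⟩
  · have hWz : W.starProjection z = W.starProjection (U.starProjection z) :=
      (congrArg (fun f => f z) (Submodule.starProjection_comp_starProjection_of_le hWU)).symm
    rw [hWz]
    have hU : U ≤ (Submodule.span ℝ (T : Set E)).comap
        (LinearMap.id - (W.starProjection : E →ₗ[ℝ] E)) := by
      refine Submodule.span_le.2 ?_
      rintro _ ⟨j, hj, rfl⟩
      simp only [SetLike.mem_coe, Submodule.mem_comap, LinearMap.sub_apply, LinearMap.id_apply,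
        ContinuousLinearMap.coe_coe]
      by_cases hjK : j ∈ K
      · have : x j ∈ W := Submodule.subset_span ⟨j, by exact_mod_cast hjK, rfl⟩
        rw [Submodule.starProjection_eq_self_iff.2 this, sub_self]
        exact Submodule.zero_mem _
      · refine Submodule.subset_span ?_
        simp only [T, coe_insert, coe_image, Set.mem_insert_iff]
        exact Or.inr ⟨j, by simpa [hjK] using hj, rfl⟩
    simpa using hU (U.starProjection_apply_mem z)
  · refine (finrank_span_finset_le_card T).trans ((Finset.card_insert_le _ _).trans ?_)
    exact Nat.add_le_add_right Finset.card_image_le 1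

lemma sum_pow_card_symmDiff_s18 {ι : Type*} [Fintype ι] [DecidableEq ι] (S : Finset ι) (x : ℝ) :
    ∑ J : Finset ι, x ^ (symmDiff J S).card = (1 + x) ^ Fintype.card ι := by
  rw [(symmDiff_left_involutive S).bijective.sum_comp (fun J : Finset ι => x ^ J.card)]
  have h := Finset.sum_pow_mul_eq_add_pow x 1 (Finset.univ : Finset ι)
  simp only [one_pow, mul_one, Finset.powerset_univ, Finset.card_univ] at h
  rw [h, add_comm]

lemma sum_inv_sq_pow_card_symmDiff_le {p : ℕ} (hp : 2 ≤ p) (S : Finset (Fin p)) :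
    ∑ J : Finset (Fin p), (((p : ℝ) ^ 2)⁻¹) ^ (symmDiff J S).card ≤ 2 := by
  rw [sum_pow_card_symmDiff_s18, Fintype.card_fin]
  have hp' : (2 : ℝ) ≤ p := by exact_mod_cast hp
  have h1 : (1 + ((p : ℝ) ^ 2)⁻¹) ^ p ≤ Real.exp (((p : ℝ) ^ 2)⁻¹) ^ p := by
    gcongr
    linarith [Real.add_one_le_exp (((p : ℝ) ^ 2)⁻¹)]
  rw [← Real.exp_nat_mul] at h1
  have h2 : (p : ℝ) * ((p : ℝ) ^ 2)⁻¹ ≤ 1 / 2 := by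
    have : (p : ℝ) * ((p : ℝ) ^ 2)⁻¹ = 1 / p := by field_simp
    rw [this]
    gcongr
  have h3 : Real.exp (1 / 2) ≤ 2 := by
    have h4 : Real.exp (1 / 2) ^ 2 = Real.exp 1 := by
      rw [← Real.exp_nat_mul]; norm_num
    nlinarith [Real.exp_one_lt_d9, Real.exp_pos (1 / 2)]
  exact h1.trans ((Real.exp_le_exp.2 h2).trans h3)

lemma tail_factor_le {p d k D : ℕ} (hp : 2 ≤ p) {c : ℝ} (hc : 0 < c) (hk : 1 ≤ k)
    (hd : d ≤ k + 1) (hD : D ≤ 2 * k) :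
    √2 ^ d * Real.exp (-((5 + c) * k * Real.log p))
      ≤ (p : ℝ) ^ (-c) * (((p : ℝ) ^ 2)⁻¹) ^ D := by
  have hp' : (2 : ℝ) ≤ p := by exact_mod_cast hp
  have hp0 : (0 : ℝ) < p := by linarith
  have h1 : √2 ^ d ≤ (p : ℝ) ^ k := by
    calc √2 ^ d ≤ √2 ^ (2 * k) := by
          apply pow_le_pow_right₀ (by rw [Real.one_le_sqrt]; norm_num) (by omega)
      _ = 2 ^ k := by rw [pow_mul, Real.sq_sqrt (by norm_num)]
      _ ≤ (p : ℝ) ^ k := by gcongr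
  have h2 : Real.exp (-((5 + c) * k * Real.log p)) ≤ (p : ℝ) ^ (-c) * ((p : ℝ) ^ (5 * k))⁻¹ := by
    rw [← Real.rpow_natCast, ← Real.rpow_neg hp0.le, ← Real.rpow_add hp0,
      Real.rpow_def_of_pos hp0]
    apply Real.exp_le_exp.2
    have hl : 0 ≤ Real.log p := Real.log_nonneg (by linarith)
    have hk' : (1 : ℝ) ≤ k := by exact_mod_cast hk
    push_cast
    nlinarith [mul_nonneg (mul_nonneg hc.le hl) (sub_nonneg.2 hk')]
  have h3 : ((p : ℝ) ^ (4 * k))⁻¹ ≤ (((p : ℝ) ^ 2)⁻¹) ^ D := by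
    rw [inv_pow, ← pow_mul]
    exact inv_anti₀ (by positivity) (pow_le_pow_right₀ (by linarith) (by omega))
  calc √2 ^ d * Real.exp (-((5 + c) * k * Real.log p))
      ≤ (p : ℝ) ^ k * ((p : ℝ) ^ (-c) * ((p : ℝ) ^ (5 * k))⁻¹) := by gcongr
    _ = (p : ℝ) ^ (-c) * ((p : ℝ) ^ (4 * k))⁻¹ := by
        rw [show 5 * k = k + 4 * k by ring, pow_add]
        field_simp
    _ ≤ _ := by gcongr

lemma toLp_mulVec_mem_span {n p : ℕ} (X : Matrix (Fin n) (Fin p) ℝ) (J : Finset (Fin p))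
    {cf : Fin p → ℝ} (hcf : ∀ j ∉ J, cf j = 0) :
    WithLp.toLp 2 (X.mulVec cf) ∈ (Submodule.span ℝ
      ((fun j => WithLp.toLp 2 fun i => X i j) '' (J : Set (Fin p)))
      : Submodule ℝ (EuclideanSpace ℝ (Fin n))) := by
  have h : (WithLp.toLp 2 (X.mulVec cf) : EuclideanSpace ℝ (Fin n))
      = ∑ j, cf j • WithLp.toLp 2 fun i => X i j := by
    ext i
    simp [Matrix.mulVec, dotProduct, mul_comm]
  rw [h]
  refine Submodule.sum_mem _ fun j _ => ?_
  by_cases hj : j ∈ J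
  · exact Submodule.smul_mem _ _ (Submodule.subset_span ⟨j, by exact_mod_cast hj, rfl⟩)
  · rw [hcf j hj, zero_smul]
    exact Submodule.zero_mem _

lemma toLp_eq_starProjection_span {n p : ℕ} (X : Matrix (Fin n) (Fin p) ℝ) (J : Finset (Fin p))
    {v u : Fin n → ℝ} (hu : ∃ cf : Fin p → ℝ, (∀ j ∉ J, cf j = 0) ∧ u = X.mulVec cf)
    (horth : ∀ j ∈ J, ∑ i, (v i - u i) * X i j = 0) :
    WithLp.toLp 2 u = (Submodule.span ℝ
      ((fun j => WithLp.toLp 2 fun i => X i j) '' (J : Set (Fin p)))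
      : Submodule ℝ (EuclideanSpace ℝ (Fin n))).starProjection (WithLp.toLp 2 v) := by
  symm
  apply Submodule.eq_starProjection_of_mem_orthogonal
  · obtain ⟨cf, hcf, rfl⟩ := hu
    exact toLp_mulVec_mem_span X J hcf
  · rw [Submodule.mem_orthogonal]
    intro w hw
    induction hw using Submodule.span_induction with
    | mem w hw =>
      obtain ⟨j, hj, rfl⟩ := hw
      simpa [PiLp.inner_apply] using horth j (by exact_mod_cast hj)
    | zero => simp
    | add a b _ _ ha hb => rw [inner_add_left, ha, hb, add_zero]
    | smul r a _ ha => rw [real_inner_smul_left, ha, mul_zero]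

theorem stmt18
    (n p : ℕ) (hn : 1 ≤ n) (hnp : n ≤ p) (hp2 : 2 ≤ p)
    (X : Matrix (Fin n) (Fin p) ℝ)
    (hX : ∀ j, Real.sqrt (∑ i, (X i j)^2) = Real.sqrt n)
    (σ : ℝ) (hσ : 0 < σ)
    (P : Finset (Fin p) → (Fin n → ℝ) → (Fin n → ℝ))
    (hP : ∀ (J : Finset (Fin p)) (v : Fin n → ℝ),
        (∃ cf : Fin p → ℝ, (∀ j ∉ J, cf j = 0) ∧ P J v = X.mulVec cf)
        ∧ ∀ j ∈ J, (∑ i, (v i - P J v i) * X i j) = 0)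
    (μ : Measure (Fin n → ℝ))
    (hμ : μ = Measure.pi (fun _ : Fin n => gaussianReal 0 (Real.toNNReal (σ^2))))
    (βs : Fin p → ℝ) (sstar : ℕ) (hs1 : 1 ≤ sstar)
    (Jstar : Finset (Fin p)) (hJstar : Jstar = Finset.univ.filter (fun j => βs j ≠ 0))
    (hcard : Jstar.card = sstar)
    (y : (Fin n → ℝ) → Fin n → ℝ)
    (hy : ∀ z i, y z i = X.mulVec βs i + z i)
    (c : ℝ) (hc : 0 < c)
    :
    ENNReal.ofReal (1 - 2 * (p : ℝ) ^ (-c)) ≤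
      μ {z | ∀ J : Finset (Fin p), J ≠ Jstar →
        ∑ i, y z i * (P J (y z) i - P Jstar (y z) i)
          ≤ (40 + 8 * c) * σ^2 * ((max J.card sstar - (J ∩ Jstar).card : ℕ) : ℝ)
              * Real.log p
            - (1/2) * ∑ i, (X.mulVec βs i - P J (X.mulVec βs) i)^2} := by
  have hv : Real.toNNReal (σ ^ 2) ≠ 0 := (Real.toNNReal_pos.2 (by positivity)).ne'
  have hvc : ((Real.toNNReal (σ ^ 2) : NNReal) : ℝ) = σ ^ 2 := Real.coe_toNNReal _ (by positivity)
  set R : Finset (Fin p) → (Fin n → ℝ) → ℝ := fun J z => (40 + 8 * c) * σ^2 *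
      ((max J.card sstar - (J ∩ Jstar).card : ℕ) : ℝ) * Real.log p
        - (1/2) * ∑ i, (X.mulVec βs i - P J (X.mulVec βs) i)^2 with hR
  set Q : Finset (Fin p) → (Fin n → ℝ) → ℝ :=
    fun J z => ∑ i, y z i * (P J (y z) i - P Jstar (y z) i) with hQ
  have hprob : IsProbabilityMeasure μ := by rw [hμ]; infer_instance
  have hbad : ∀ J : Finset (Fin p), J ≠ Jstar → μ {z | R J z < Q J z} ≤
      ENNReal.ofReal ((p : ℝ) ^ (-c) * (((p : ℝ) ^ 2)⁻¹) ^ (symmDiff J Jstar).card) := by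
    intro J hJ
    set k := max J.card sstar - (J ∩ Jstar).card with hk
    have hc1 := Finset.card_sdiff_add_card_inter J Jstar
    have hc2 := Finset.card_sdiff_add_card_inter Jstar J
    rw [Finset.inter_comm, hcard] at hc2
    have hsd : (symmDiff J Jstar).card = (J \ Jstar).card + (Jstar \ J).card := by
      rw [symmDiff_def, Finset.sup_eq_union, Finset.card_union_of_disjoint disjoint_sdiff_sdiff]
    have hpos : 0 < (symmDiff J Jstar).card := by
      rw [Finset.card_pos, Finset.nonempty_iff_ne_empty]
      exact fun h => hJ (symmDiff_eq_bot.1 h)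
    have hsdiff : (J \ (J ∩ Jstar)).card = (J \ Jstar).card := by rw [Finset.sdiff_inter_self_left]
    obtain ⟨V, hmV, hzV, hVd⟩ := exists_submodule_finrank_le
      (fun j => (WithLp.toLp 2 fun i => X i j : EuclideanSpace ℝ (Fin n)))
      (Finset.inter_subset_left : J ∩ Jstar ⊆ J)
      (WithLp.toLp 2 (X.mulVec βs) - WithLp.toLp 2 (P J (X.mulVec βs)))
    have hproj : ∀ J v, _ := fun J v => toLp_eq_starProjection_span X J (hP J v).1 (hP J v).2
    refine le_trans (measure_mono ?_) ((hμ ▸ measure_le_norm_sq_starProjection_le hv V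
      ((5 + c) * k * Real.log p)).trans (ENNReal.ofReal_le_ofReal
        (tail_factor_le hp2 hc (k := k) (by omega)
          (hVd.trans (by omega)) (by omega))))
    intro z hz
    simp only [Set.mem_ofPred_eq] at hz ⊢
    rw [hproj] at hmV
    have hdet := inner_starProjection_sub_le
      (Submodule.span_mono (Set.image_mono (by simp)))
      (Submodule.span_mono (Set.image_mono (by simp)))
      (toLp_mulVec_mem_span X Jstar (cf := βs) (by simp [hJstar])) hmV (hzV (WithLp.toLp 2 z))
    have hyz : (WithLp.toLp 2 (X.mulVec βs) + WithLp.toLp 2 z : EuclideanSpace ℝ (Fin n))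
        = WithLp.toLp 2 (y z) := by
      ext i; simp [hy]
    rw [hyz, ← hproj, ← hproj, ← hproj, EuclideanSpace.real_norm_sq_eq (_ - _)] at hdet
    simp only [PiLp.inner_apply, PiLp.sub_apply, RCLike.inner_apply, conj_trivial] at hdet
    have hQd : Q J z ≤ 2 * ‖V.starProjection (WithLp.toLp 2 z)‖ ^ 2
        - 1 / 2 * ∑ i, (X.mulVec βs i - P J (X.mulVec βs) i) ^ 2 := by
      refine le_trans (le_of_eq ?_) hdet
      exact Finset.sum_congr rfl fun i _ => mul_comm _ _
    have hlt := hz.trans_le hQd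
    simp only [hR] at hlt
    rw [hvc, inv_mul_eq_div, le_div_iff₀ (by positivity)]
    linarith
  set G := {z | ∀ J : Finset (Fin p), J ≠ Jstar → Q J z ≤ R J z} with hG
  have hp0 : (0 : ℝ) < p := by positivity
  have hcompl : μ Gᶜ ≤ ENNReal.ofReal (2 * (p : ℝ) ^ (-c)) := by
    have hsub : Gᶜ ⊆ ⋃ J ∈ Finset.univ.filter (fun J => J ≠ Jstar), {z | R J z < Q J z} := by
      intro z hz
      simpa [hG] using hz
    calc μ Gᶜ ≤ ∑ J ∈ Finset.univ.filter (fun J => J ≠ Jstar), μ {z | R J z < Q J z} :=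
          (measure_mono hsub).trans (measure_biUnion_finset_le _ _)
      _ ≤ ∑ J ∈ Finset.univ.filter (fun J => J ≠ Jstar), ENNReal.ofReal
            ((p : ℝ) ^ (-c) * (((p : ℝ) ^ 2)⁻¹) ^ (symmDiff J Jstar).card) :=
          Finset.sum_le_sum fun J hJ => hbad J (Finset.mem_filter.1 hJ).2
      _ ≤ ∑ J : Finset (Fin p), ENNReal.ofReal
            ((p : ℝ) ^ (-c) * (((p : ℝ) ^ 2)⁻¹) ^ (symmDiff J Jstar).card) :=
          Finset.sum_le_sum_of_subset (Finset.filter_subset _ _)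
      _ ≤ ENNReal.ofReal (2 * (p : ℝ) ^ (-c)) := by
          rw [← ENNReal.ofReal_sum_of_nonneg fun J _ => by positivity, ← Finset.mul_sum,
            mul_comm 2]
          gcongr
          exact sum_inv_sq_pow_card_symmDiff_le hp2 Jstar
  have huniv : 1 ≤ μ G + μ Gᶜ := by
    rw [← measure_univ (μ := μ), ← Set.union_compl_self G]
    exact measure_union_le _ _
  rw [ENNReal.ofReal_sub _ (by positivity), ENNReal.ofReal_one]
  exact tsub_le_iff_right.2 (huniv.trans (by gcongr))
end

section
/- For any c > 0, with probability at least 1 − p^(−c) over the Gaussian noise z, simultaneously for every subset J ⊆ {1,…,p}: ‖P_{J⋆}^⊥ z‖₂² − ‖P_J^⊥ y‖₂² ≤ 6σ²·(20 + 4c)·(|J| + s⋆)·log p − (1/2)·‖P_J y − Xβ⋆‖₂². -/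
open MeasureTheory ProbabilityTheory Finset
open scoped Classical ENNReal

theorem lintegral_exp_sq_gaussianReal {σ : ℝ} (hσ : 0 < σ) :
    ∫⁻ x, ENNReal.ofReal (Real.exp (3 / 8 * (x ^ 2 / σ ^ 2)))
      ∂(gaussianReal 0 (Real.toNNReal (σ ^ 2))) = 2 := by
  have hv : Real.toNNReal (σ ^ 2) ≠ 0 := (Real.toNNReal_pos.2 (by positivity)).ne'
  have hw : Real.toNNReal (4 * σ ^ 2) ≠ 0 := (Real.toNNReal_pos.2 (by positivity)).ne'
  rw [gaussianReal_of_var_ne_zero _ hv, lintegral_withDensity_eq_lintegral_mul _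
    (measurable_gaussianPDF _ _) (by fun_prop)]
  have key : ∀ x, (gaussianPDF 0 (Real.toNNReal (σ ^ 2)) *
      fun x => ENNReal.ofReal (Real.exp (3 / 8 * (x ^ 2 / σ ^ 2)))) x =
      2 * gaussianPDF 0 (Real.toNNReal (4 * σ ^ 2)) x := by
    intro x
    rw [Pi.mul_apply, gaussianPDF, gaussianPDF, ← ENNReal.ofReal_mul (gaussianPDFReal_nonneg _ _ _),
      show (2 : ℝ≥0∞) = ENNReal.ofReal (2 : ℝ) by simp, ← ENNReal.ofReal_mul (by norm_num)]
    congr 1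
    simp only [gaussianPDFReal, sub_zero]
    rw [Real.coe_toNNReal _ (by positivity), Real.coe_toNNReal _ (by positivity), mul_assoc,
      ← Real.exp_add,
      show 2 * Real.pi * (4 * σ ^ 2) = 2 ^ 2 * (2 * Real.pi * σ ^ 2) by ring,
      Real.sqrt_mul (by positivity : (0 : ℝ) ≤ 2 ^ 2), Real.sqrt_sq zero_le_two, mul_inv,
      mul_assoc 2⁻¹, mul_inv_cancel_left₀ two_ne_zero]
    congr 2
    field_simp
    ring
  simp_rw [key]
  rw [lintegral_const_mul _ (measurable_gaussianPDF _ _), lintegral_gaussianPDF_eq_one _ hw, mul_one]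

theorem map_inner_pi_gaussianReal {ι κ : Type*} [Fintype ι] [Fintype κ] (v : NNReal)
    {e : κ → EuclideanSpace ℝ ι} (he : Orthonormal ℝ e) :
    (Measure.pi (fun _ : ι => gaussianReal 0 v)).map (fun z k => ∑ i, z i * e k i) =
      Measure.pi (fun _ : κ => gaussianReal 0 v) := by
  have hm : Measurable (fun (z : ι → ℝ) k => ∑ i, z i * e k i) := by fun_prop
  have : IsProbabilityMeasure ((Measure.pi (fun _ : ι => gaussianReal 0 v)).map
      (fun z k => ∑ i, z i * e k i)) := Measure.isProbabilityMeasure_map hm.aemeasurable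
  refine charFun_eq_pi_iff.1 fun t => ?_
  have h1 : charFun (((Measure.pi (fun _ : ι => gaussianReal 0 v)).map
      (fun z k => ∑ i, z i * e k i)).map (WithLp.toLp 2)) t =
      charFun ((Measure.pi (fun _ : ι => gaussianReal 0 v)).map (WithLp.toLp 2))
        (∑ k, t k • e k) := by
    rw [Measure.map_map (by fun_prop) hm, charFun_apply, charFun_apply,
      integral_map ((by fun_prop : Measurable (WithLp.toLp 2)).comp hm).aemeasurable (by fun_prop),
      integral_map (by fun_prop) (by fun_prop)]
    congr 1
    ext z
    congr 3
    simp only [inner_sum, inner_smul_right, PiLp.inner_apply, Function.comp_apply]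
    simp [mul_comm]
  rw [h1, charFun_pi]
  simp_rw [charFun_gaussianReal, ← Complex.exp_sum]
  have h2 : ∑ i, ((∑ k, t k • e k : EuclideanSpace ℝ ι) i) ^ 2 = ∑ k, t k ^ 2 := by
    rw [← EuclideanSpace.real_norm_sq_eq, ← real_inner_self_eq_norm_sq,
      he.inner_sum]
    simp [sq]
  congr 1
  simp only [Complex.ofReal_zero, mul_zero, zero_mul, zero_sub, sum_neg_distrib, neg_inj,
    ← sum_div, ← mul_sum]
  congr 2
  exact_mod_cast h2

theorem measure_lt_sum_sq_pi_gaussianReal_le {κ : Type*} [Fintype κ] {σ : ℝ} (hσ : 0 < σ)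
    (T : ℝ) :
    Measure.pi (fun _ : κ => gaussianReal 0 (Real.toNNReal (σ ^ 2)))
      {g | σ ^ 2 * T < ∑ k, g k ^ 2} ≤
      ENNReal.ofReal (2 ^ Fintype.card κ * Real.exp (-(3 / 8 * T))) := by
  set ν := Measure.pi (fun _ : κ => gaussianReal 0 (Real.toNNReal (σ ^ 2)))
  have hI : ∫⁻ g, ∏ k, ENNReal.ofReal (Real.exp (3 / 8 * (g k ^ 2 / σ ^ 2))) ∂ν =
      2 ^ Fintype.card κ := by
    have hind : iIndepFun (fun k (g : κ → ℝ) =>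
        ENNReal.ofReal (Real.exp (3 / 8 * (g k ^ 2 / σ ^ 2)))) ν :=
      iIndepFun_pi (X := fun _ x => ENNReal.ofReal (Real.exp (3 / 8 * (x ^ 2 / σ ^ 2))))
        (fun _ => by fun_prop)
    rw [lintegral_prod_eq_prod_lintegral_of_indepFun univ _ hind (fun _ => by fun_prop)]
    have : ∀ k, ∫⁻ g, ENNReal.ofReal (Real.exp (3 / 8 * (g k ^ 2 / σ ^ 2))) ∂ν = 2 := fun k => by
      rw [← lintegral_exp_sq_gaussianReal hσ]
      exact (measurePreserving_eval
        (fun _ : κ => gaussianReal 0 (Real.toNNReal (σ ^ 2))) k).lintegral_comp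
        (f := fun x => ENNReal.ofReal (Real.exp (3 / 8 * (x ^ 2 / σ ^ 2)))) (by fun_prop)
    simp [this]
  have hM := mul_meas_ge_le_lintegral (μ := ν)
    (f := fun g => ∏ k, ENNReal.ofReal (Real.exp (3 / 8 * (g k ^ 2 / σ ^ 2))))
    (by fun_prop) (ENNReal.ofReal (Real.exp (3 / 8 * T)))
  rw [hI] at hM
  have hsub : {g : κ → ℝ | σ ^ 2 * T < ∑ k, g k ^ 2} ⊆
      {g | ENNReal.ofReal (Real.exp (3 / 8 * T)) ≤
        ∏ k, ENNReal.ofReal (Real.exp (3 / 8 * (g k ^ 2 / σ ^ 2)))} := by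
    intro g hg
    simp only [Set.mem_ofPred_eq] at hg ⊢
    rw [← ENNReal.ofReal_prod_of_nonneg (fun _ _ => (Real.exp_pos _).le), ← Real.exp_sum,
      ← mul_sum, ← sum_div]
    refine ENNReal.ofReal_le_ofReal (Real.exp_le_exp.2 ?_)
    have : T ≤ (∑ k, g k ^ 2) / σ ^ 2 := by
      rw [le_div_iff₀ (by positivity)]; linarith
    linarith
  refine (measure_mono hsub).trans ?_
  rw [Real.exp_neg, ← div_eq_mul_inv, ENNReal.ofReal_div_of_pos (Real.exp_pos _),
    ENNReal.le_div_iff_mul_le (by simp [Real.exp_pos]) (by simp), mul_comm]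
  simpa [ENNReal.ofReal_pow] using hM

theorem exists_orthonormal_two_mul_inner_le {E ι : Type*} [NormedAddCommGroup E]
    [InnerProductSpace ℝ E] [FiniteDimensional ℝ E] (x : ι → E) (K : Finset ι) :
    ∃ (r : ℕ) (e : Fin r → E), r ≤ #K ∧ Orthonormal ℝ e ∧
      ∀ (z : E) (a : ι → ℝ), 2 * inner ℝ z (∑ j ∈ K, a j • x j) ≤
        2 * ∑ k, inner ℝ z (e k) ^ 2 + 1 / 2 * ‖∑ j ∈ K, a j • x j‖ ^ 2 := by
  set S := Submodule.span ℝ ((K.image x : Finset E) : Set E) with hS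
  set b := stdOrthonormalBasis ℝ S
  refine ⟨Module.finrank ℝ S, fun k => b k,
    (finrank_span_finset_le_card (K.image x)).trans card_image_le,
    b.orthonormal.comp_linearIsometry S.subtypeₗᵢ, fun z a => ?_⟩
  have hw : ∑ j ∈ K, a j • x j ∈ S := Submodule.sum_mem _ fun j hj =>
    S.smul_mem _ (Submodule.subset_span (by simpa using ⟨j, hj, rfl⟩))
  generalize ∑ j ∈ K, a j • x j = w at hw
  lift w to S using hw
  have h1 : inner ℝ z (w : E) = inner ℝ (S.orthogonalProjectionOnto z) w := by
    simp
  have h2 : ∑ k, inner ℝ z (b k : E) ^ 2 = ‖S.orthogonalProjectionOnto z‖ ^ 2 := by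
    rw [← b.sum_sq_inner_left]
    simp
  rw [h1, h2, ← Submodule.coe_norm]
  have h3 := norm_sub_sq_real ((2 : ℝ) • S.orthogonalProjectionOnto z) w
  rw [real_inner_smul_left, norm_smul, Real.norm_two, mul_pow] at h3
  linarith [sq_nonneg ‖(2 : ℝ) • S.orthogonalProjectionOnto z - w‖]

theorem sum_pow_card_inv_le_exp_one (p : ℕ) :
    ∑ J : Finset (Fin p), ((p : ℝ)⁻¹) ^ #J ≤ Real.exp 1 := by
  have h := Fintype.sum_pow_mul_eq_add_pow (Fin p) ((p : ℝ)⁻¹) 1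
  simp only [one_pow, mul_one, Fintype.card_fin] at h
  rw [h]
  calc ((p : ℝ)⁻¹ + 1) ^ p ≤ Real.exp ((p : ℝ)⁻¹) ^ p :=
        pow_le_pow_left₀ (by positivity) (Real.add_one_le_exp _) p
    _ = Real.exp (p * (p : ℝ)⁻¹) := (Real.exp_nat_mul _ _).symm
    _ ≤ Real.exp 1 := Real.exp_le_exp.2 mul_inv_le_one

theorem two_pow_mul_exp_le {p r k s : ℕ} (hp : 2 ≤ p) (hs : 1 ≤ s) (hr : r ≤ k + s) {c : ℝ}
    (hc : 0 < c) :
    2 ^ r * Real.exp (-(3 / 8 * (3 * (20 + 4 * c) * (k + s) * Real.log p))) ≤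
      Real.exp (-(2 + c) * Real.log p) * ((p : ℝ)⁻¹) ^ k := by
  have hp0 : (0 : ℝ) < p := by positivity
  have hL : 0 ≤ Real.log p := Real.log_natCast_nonneg p
  have hs' : (1 : ℝ) ≤ s := by exact_mod_cast hs
  have h1 : (2 : ℝ) ^ r ≤ Real.exp ((k + s) * Real.log p) := by
    calc (2 : ℝ) ^ r ≤ 2 ^ (k + s) := pow_le_pow_right₀ one_le_two hr
      _ ≤ (p : ℝ) ^ (k + s) := pow_le_pow_left₀ zero_le_two (by exact_mod_cast hp) _
      _ = Real.exp ((k + s) * Real.log p) := by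
        rw [← Nat.cast_add, Real.exp_nat_mul, Real.exp_log hp0]
  have h2 : ((p : ℝ)⁻¹) ^ k = Real.exp (k * -Real.log p) := by
    rw [Real.exp_nat_mul, Real.exp_neg, Real.exp_log hp0]
  rw [h2, ← Real.exp_add]
  refine (mul_le_mul_of_nonneg_right h1 (Real.exp_pos _).le).trans ?_
  rw [← Real.exp_add, Real.exp_le_exp]
  have h3 : 2 + c + k ≤ (43 / 2 + 9 / 2 * c) * (k + s) := by
    nlinarith [mul_nonneg hc.le (Nat.cast_nonneg (α := ℝ) k), Nat.cast_nonneg (α := ℝ) k]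
  linarith [mul_le_mul_of_nonneg_right h3 hL]

theorem stmt19
    (n p : ℕ) (hn : 1 ≤ n) (hnp : n ≤ p) (hp2 : 2 ≤ p)
    (X : Matrix (Fin n) (Fin p) ℝ)
    (hX : ∀ j, Real.sqrt (∑ i, (X i j)^2) = Real.sqrt n)
    (σ : ℝ) (hσ : 0 < σ)
    (P : Finset (Fin p) → (Fin n → ℝ) → (Fin n → ℝ))
    (hP : ∀ (J : Finset (Fin p)) (v : Fin n → ℝ),
        (∃ cf : Fin p → ℝ, (∀ j ∉ J, cf j = 0) ∧ P J v = X.mulVec cf)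
        ∧ ∀ j ∈ J, (∑ i, (v i - P J v i) * X i j) = 0)
    (μ : Measure (Fin n → ℝ))
    (hμ : μ = Measure.pi (fun _ : Fin n => gaussianReal 0 (Real.toNNReal (σ^2))))
    (βs : Fin p → ℝ) (sstar : ℕ) (hs1 : 1 ≤ sstar)
    (Jstar : Finset (Fin p)) (hJstar : Jstar = Finset.univ.filter (fun j => βs j ≠ 0))
    (hcard : Jstar.card = sstar)
    (y : (Fin n → ℝ) → Fin n → ℝ)
    (hy : ∀ z i, y z i = X.mulVec βs i + z i)
    (c : ℝ) (hc : 0 < c)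
    :
    ENNReal.ofReal (1 - (p : ℝ) ^ (-c)) ≤
      μ {z | ∀ J : Finset (Fin p),
        (∑ i, (z i - P Jstar z i)^2) - (∑ i, (y z i - P J (y z) i)^2)
          ≤ 6 * σ^2 * (20 + 4 * c) * ((J.card : ℝ) + (sstar : ℝ)) * Real.log p
            - (1/2) * ∑ i, (P J (y z) i - X.mulVec βs i)^2} := by
  have hμ1 : IsProbabilityMeasure μ := by rw [hμ]; infer_instance
  have hp0 : (0 : ℝ) < p := by positivity
  choose r e hr he hbound using fun J : Finset (Fin p) =>
    exists_orthonormal_two_mul_inner_le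
      (fun j => (WithLp.toLp 2 (fun i => X i j) : EuclideanSpace ℝ (Fin n))) (J ∪ Jstar)
  set T : Finset (Fin p) → ℝ := fun J => 3 * (20 + 4 * c) * (#J + sstar) * Real.log p with hT
  set B : Finset (Fin p) → Set (Fin n → ℝ) := fun J =>
    (fun z k => ∑ i, z i * e J k i) ⁻¹' {g | σ ^ 2 * T J < ∑ k, g k ^ 2} with hB
  have hμB : ∀ J, μ (B J) ≤ ENNReal.ofReal
      (Real.exp (-(2 + c) * Real.log p) * ((p : ℝ)⁻¹) ^ #J) := fun J => by
    have hm : MeasurableSet {g : Fin (r J) → ℝ | σ ^ 2 * T J < ∑ k, g k ^ 2} :=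
      measurableSet_lt (by fun_prop) (by fun_prop)
    rw [hB, hμ, ← Measure.map_apply (by fun_prop) hm, map_inner_pi_gaussianReal _ (he J)]
    refine (measure_lt_sum_sq_pi_gaussianReal_le hσ (T J)).trans (ENNReal.ofReal_le_ofReal ?_)
    rw [Fintype.card_fin]
    exact two_pow_mul_exp_le hp2 hs1
      ((hr J).trans ((card_union_le _ _).trans (by rw [hcard]))) hc
  have hμU : μ (⋃ J ∈ (univ : Finset (Finset (Fin p))), B J) ≤
      ENNReal.ofReal ((p : ℝ) ^ (-c)) := by
    refine (measure_biUnion_finset_le _ _).trans ((sum_le_sum fun J _ => hμB J).trans ?_)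
    rw [← ENNReal.ofReal_sum_of_nonneg (fun _ _ => by positivity), ← mul_sum]
    refine ENNReal.ofReal_le_ofReal ((mul_le_mul_of_nonneg_left
      (sum_pow_card_inv_le_exp_one p) (Real.exp_pos _).le).trans ?_)
    rw [← Real.exp_add, Real.rpow_def_of_pos hp0, Real.exp_le_exp]
    have := Real.log_le_log zero_lt_two (by exact_mod_cast hp2 : (2 : ℝ) ≤ p)
    linarith [Real.log_two_gt_d9]
  refine le_trans ?_ (measure_mono (s := (⋃ J ∈ (univ : Finset (Finset (Fin p))), B J)ᶜ) ?_)
  · rw [ENNReal.ofReal_sub _ (by positivity), ENNReal.ofReal_one, tsub_le_iff_right]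
    calc (1 : ℝ≥0∞) = μ Set.univ := measure_univ.symm
      _ ≤ _ := by
        rw [← Set.compl_union_self (⋃ J ∈ (univ : Finset (Finset (Fin p))), B J)]
        exact (measure_union_le _ _).trans (add_le_add_right hμU _)
  intro z hz J
  have hzJ : ∑ k, (∑ i, z i * e J k i) ^ 2 ≤ σ ^ 2 * T J := by
    by_contra h
    exact hz (Set.mem_biUnion (mem_univ J) (not_le.1 h))
  obtain ⟨⟨cf, hcf, hPJ⟩, -⟩ := hP J (y z)
  obtain ⟨⟨cs, hcs, hPs⟩, horth⟩ := hP Jstar z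
  have hproj : ∑ i, (z i - P Jstar z i) ^ 2 ≤ ∑ i, z i ^ 2 := by
    have h0 : ∑ i, (z i - P Jstar z i) * P Jstar z i = 0 := by
      have : ∀ i, P Jstar z i = ∑ j, X i j * cs j := fun i => by rw [hPs]; rfl
      calc ∑ i, (z i - P Jstar z i) * P Jstar z i
          = ∑ i, ∑ j, (z i - P Jstar z i) * X i j * cs j := by
            refine sum_congr rfl fun i _ => ?_
            simp_rw [mul_assoc, ← mul_sum, ← this i]
        _ = ∑ j, (∑ i, (z i - P Jstar z i) * X i j) * cs j := by
            rw [sum_comm]; simp_rw [sum_mul]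
        _ = 0 := sum_eq_zero fun j _ => by
            by_cases hj : j ∈ Jstar
            · rw [horth j hj, zero_mul]
            · rw [hcs j hj, mul_zero]
    have h1 : ∑ i, z i ^ 2 = ∑ i, (z i - P Jstar z i) ^ 2 +
        2 * ∑ i, (z i - P Jstar z i) * P Jstar z i + ∑ i, P Jstar z i ^ 2 := by
      rw [mul_sum, ← sum_add_distrib, ← sum_add_distrib]
      exact sum_congr rfl fun i _ => by ring
    have h2 : 0 ≤ ∑ i, P Jstar z i ^ 2 := sum_nonneg fun i _ => sq_nonneg _
    linarith
  set w : Fin n → ℝ := fun i => P J (y z) i - X.mulVec βs i with hw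
  have hres : ∑ i, (y z i - P J (y z) i) ^ 2 =
      ∑ i, z i ^ 2 - 2 * ∑ i, z i * w i + ∑ i, w i ^ 2 := by
    rw [mul_sum, ← sum_sub_distrib, ← sum_add_distrib]
    exact sum_congr rfl fun i _ => by rw [hy]; ring
  have hspan : ∑ j ∈ J ∪ Jstar, (cf j - βs j) •
      (WithLp.toLp 2 (fun i => X i j) : EuclideanSpace ℝ (Fin n)) = WithLp.toLp 2 w := by
    ext i
    have : ∀ j ∉ J ∪ Jstar, (cf j - βs j) * X i j = 0 := fun j hj => by
      rw [mem_union, not_or] at hj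
      have hβ : βs j = 0 := by
        have := hj.2
        simpa [hJstar] using this
      rw [hcf j hj.1, hβ, sub_zero, zero_mul]
    have hwX : w = X.mulVec (cf - βs) := by
      rw [Matrix.mulVec_sub, ← hPJ]
      rfl
    rw [hwX]
    simp only [WithLp.ofLp_sum, WithLp.ofLp_smul, Finset.sum_apply, Pi.smul_apply, smul_eq_mul]
    rw [sum_subset (subset_univ _) fun j _ hj => this j hj]
    simp [Matrix.mulVec, dotProduct, mul_comm]
  have hmain := hbound J (WithLp.toLp 2 z) (fun j => cf j - βs j)
  rw [hspan, EuclideanSpace.real_norm_sq_eq] at hmain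
  have hin : ∀ v : EuclideanSpace ℝ (Fin n), inner ℝ (WithLp.toLp 2 z) v = ∑ i, z i * v i :=
    fun v => by simp [PiLp.inner_apply, mul_comm]
  simp only [hin] at hmain
  have hTJ : T J = 3 * (20 + 4 * c) * (#J + sstar) * Real.log p := rfl
  rw [hTJ] at hzJ
  linarith
end
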